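/- arXiv:1901.00185 — 2 statements merged into one kernel-verified Lean document; each statement's English description precedes it below -/
import Mathlib

section
/- Let P be a two-color grid poset with the max property and let L := J_color(P). Suppose L is M-structured for M = [[2,−1],[−1,2]]. Write (a,b) := wt(max). Let W be the subgroup of GL₂(ℤ) generated by S_α := [[−1,0],[1,1]] and S_β := [[1,1],[0,−1]] (a finite group of order 6). Then in the group ring ℤ[ℤ²]: (Σ_{s∈L} e^{wt(s)}) · (Σ_{w∈W} det(w) e^{w·(1,1)}) = Σ_{w∈W} det(w) e^{w·(a+1,b+1)}. -/
open scoped Classical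

structure GridData (P : Type) [PartialOrder P] where
  m : ℕ
  chain : P → ℕ
  color : P → Fin 2

def IsIdeal {P : Type} [PartialOrder P] (t : Finset P) : Prop :=
  ∀ ⦃x⦄, x ∈ t → ∀ ⦃y⦄, y ≤ x → y ∈ t

namespace GridData

variable {P : Type} [PartialOrder P] [Fintype P]

/-- The defining properties of a grid poset. -/
def IsGridPoset (G : GridData P) : Prop :=
  1 ≤ G.m ∧
  (∀ u : P, G.chain u ∈ Finset.Icc 1 G.m) ∧
  (∀ i ∈ Finset.Icc 1 G.m, ∃ u : P, G.chain u = i) ∧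
  (∀ u v : P, G.chain u = G.chain v → u ≤ v ∨ v ≤ u) ∧
  (∀ u v : P, u ⋖ v → G.chain u = G.chain v ∨ G.chain u = G.chain v + 1)

/-- The defining properties of a two-color grid poset. -/
def IsTwoColorGridPoset (G : GridData P) : Prop :=
  G.IsGridPoset ∧
  (∀ u v : P, G.chain u = G.chain v → G.color u = G.color v) ∧
  (∀ u v : P, Relation.ReflTransGen (fun x y : P => x ⋖ y ∨ y ⋖ x) u v →
    G.chain u = G.chain v + 1 → G.color u ≠ G.color v)

/-- The max property. -/
def MaxProperty (G : GridData P) : Prop :=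
  (∀ u : P, IsMax u → G.chain u ≤ 2) ∧
  (∀ u v : P, IsMax u → IsMax v → u ≠ v → G.color u ≠ G.color v)

/-- The fiber `C i` of the chain function. -/
def fiber (G : GridData P) (i : ℕ) : Finset P :=
  Finset.univ.filter (fun u => G.chain u = i)

/-- One step in a `γ`-component of `J_color(P)`: add or remove a single vertex of
color `γ` while both sets are order ideals. -/
def GStep (G : GridData P) (γ : Fin 2) (s t : Finset P) : Prop :=
  IsIdeal s ∧ IsIdeal t ∧ ∃ u : P, G.color u = γ ∧
    ((u ∉ s ∧ t = insert u s) ∨ (u ∉ t ∧ s = insert u t))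

/-- The `γ`-component of `t` in `J_color(P)`. -/
def comp (G : GridData P) (γ : Fin 2) (t : Finset P) : Set (Finset P) :=
  {s | Relation.ReflTransGen (G.GStep γ) t s}

noncomputable def minCard (G : GridData P) (γ : Fin 2) (t : Finset P) : ℕ :=
  sInf (Finset.card '' G.comp γ t)

noncomputable def maxCard (G : GridData P) (γ : Fin 2) (t : Finset P) : ℕ :=
  sSup (Finset.card '' G.comp γ t)

/-- `m_γ(t) = 2 ρ_γ(t) - l_γ(t)`. -/
noncomputable def mcoord (G : GridData P) (γ : Fin 2) (t : Finset P) : ℤ :=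
  2 * ((t.card : ℤ) - (G.minCard γ t : ℤ)) - ((G.maxCard γ t : ℤ) - (G.minCard γ t : ℤ))

/-- The weight of an element of `J_color(P)` (color `0` is α, color `1` is β). -/
noncomputable def wt (G : GridData P) (t : Finset P) : Fin 2 → ℤ :=
  ![G.mcoord 0 t, G.mcoord 1 t]

/-- `J_color(P)` is `M`-structured. -/
def MStructured (G : GridData P) (M : Matrix (Fin 2) (Fin 2) ℤ) : Prop :=
  ∀ s t : Finset P, IsIdeal s → IsIdeal t → ∀ u : P, u ∉ s → t = insert u s →
    G.wt s + M (G.color u) = G.wt t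

end GridData

/-- The set of units of the ring of 2×2 integer matrices whose underlying matrices
are the two given generators. -/
def genSet (A B : Matrix (Fin 2) (Fin 2) ℤ) : Set ((Matrix (Fin 2) (Fin 2) ℤ)ˣ) :=
  {w | (w : Matrix (Fin 2) (Fin 2) ℤ) = A ∨ (w : Matrix (Fin 2) (Fin 2) ℤ) = B}

section Helpers

set_option linter.unusedSectionVars false

variable {P : Type} [PartialOrder P] [Fintype P]

lemma exists_rev (c : P → ℕ) (hc : ∀ u v, c u = c v → u ≤ v ∨ v ≤ u) (D : Finset P) :
    ∃ φ : P → P, ∀ x ∈ D, φ x ∈ D ∧ φ (φ x) = x ∧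
      ∀ y ∈ D, c x = c y → x ≤ y → φ y ≤ φ x := by
  set F : P → Finset P := fun x => D.filter (fun y => c y = c x) with hF
  set rk : P → ℕ := fun x => (D.filter (fun y => c y = c x ∧ y ≤ x)).card with hrk
  have hlt : ∀ x y, y ∈ D → c x = c y → x < y → rk x < rk y := by
    intro x y hy hxy h
    apply Finset.card_lt_card
    refine Finset.ssubset_iff_subset_ne.2 ⟨?_, ?_⟩
    · intro z hz
      simp only [Finset.mem_filter] at hz ⊢
      exact ⟨hz.1, hz.2.1.trans hxy, hz.2.2.trans h.le⟩
    · intro he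
      have : y ∈ D.filter (fun z => c z = c x ∧ z ≤ x) := by
        rw [he]; simp [hy]
      simp only [Finset.mem_filter] at this
      exact absurd this.2.2 (not_le_of_gt h)
  have hinj : ∀ x ∈ D, ∀ y ∈ D, c x = c y → rk x = rk y → x = y := by
    intro x hx y hy hxy h
    by_contra hne
    rcases hc x y hxy with h1 | h1
    · have := hlt x y hy hxy (lt_of_le_of_ne h1 hne); omega
    · have := hlt y x hx hxy.symm (lt_of_le_of_ne h1 (Ne.symm hne)); omega
  have hmem : ∀ x ∈ D, 1 ≤ rk x ∧ rk x ≤ (F x).card := by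
    intro x hx
    constructor
    · apply Finset.card_pos.2
      exact ⟨x, by simp [hx]⟩
    · apply Finset.card_le_card
      intro z hz
      simp only [hF, Finset.mem_filter] at hz ⊢
      exact ⟨hz.1, hz.2.1⟩
  have hFe : ∀ x y, c x = c y → F x = F y := by
    intro x y h; simp only [hF, h]
  have himg : ∀ x, (F x).image rk = Finset.Icc 1 (F x).card := by
    intro x
    apply Finset.eq_of_subset_of_card_le
    · intro k hk
      obtain ⟨y, hy, rfl⟩ := Finset.mem_image.1 hk
      simp only [hF, Finset.mem_filter] at hy
      have := hmem y hy.1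
      rw [hFe y x hy.2] at this
      exact Finset.mem_Icc.2 this
    · rw [Finset.card_image_of_injOn]
      · simp
      · intro u hu v hv h
        simp only [hF, Finset.coe_filter, Set.mem_ofPred_eq] at hu hv
        exact hinj u hu.1 v hv.1 (hu.2.trans hv.2.symm) h
  have hex : ∀ x, ∃ y, x ∈ D → (y ∈ D ∧ c y = c x ∧ rk y + rk x = (F x).card + 1) := by
    intro x
    by_cases hx : x ∈ D
    · have h1 := hmem x hx
      have : (F x).card + 1 - rk x ∈ (F x).image rk := by
        rw [himg, Finset.mem_Icc]; omega
      obtain ⟨y, hy, hy2⟩ := Finset.mem_image.1 this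
      simp only [hF, Finset.mem_filter] at hy
      exact ⟨y, fun _ => ⟨hy.1, hy.2, by omega⟩⟩
    · exact ⟨x, fun h => absurd h hx⟩
  choose φ hφ using hex
  refine ⟨φ, fun x hx => ?_⟩
  obtain ⟨h1, h2, h3⟩ := hφ x hx
  obtain ⟨h4, h5, h6⟩ := hφ (φ x) h1
  refine ⟨h1, ?_, ?_⟩
  · apply hinj _ h4 _ hx (h5.trans h2)
    rw [hFe _ _ h2] at h6
    omega
  · intro y hy hxy hle
    obtain ⟨h7, h8, h9⟩ := hφ y hy
    rcases eq_or_lt_of_le hle with rfl | hl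
    · exact le_rfl
    · have hr := hlt x y hy hxy hl
      have hcc : c (φ y) = c (φ x) := by rw [h8, h2, hxy]
      rcases hc _ _ hcc with h | h
      · exact h
      · rcases eq_or_lt_of_le h with h | h
        · exact h.ge
        · have := hlt _ _ h7 hcc.symm h
          rw [hFe _ _ hxy] at h3
          omega

namespace GridData

noncomputable def lowI (G : GridData P) (γ : Fin 2) (t : Finset P) : Finset P :=
  Finset.univ.filter (fun x => ∃ y ∈ t, G.color y ≠ γ ∧ x ≤ y)

noncomputable def highI (G : GridData P) (γ : Fin 2) (t : Finset P) : Finset P :=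
  Finset.univ.filter (fun x => ∀ y, y ≤ x → G.color y ≠ γ → y ∈ t)

def Ag (G : GridData P) (γ : Fin 2) (s t : Finset P) : Prop :=
  ∀ x, G.color x ≠ γ → (x ∈ s ↔ x ∈ t)

lemma mem_low {G : GridData P} {γ : Fin 2} {t : Finset P} {x : P} :
    x ∈ G.lowI γ t ↔ ∃ y ∈ t, G.color y ≠ γ ∧ x ≤ y := by simp [lowI]

lemma mem_high {G : GridData P} {γ : Fin 2} {t : Finset P} {x : P} :
    x ∈ G.highI γ t ↔ ∀ y, y ≤ x → G.color y ≠ γ → y ∈ t := by simp [highI]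

lemma low_congr {G : GridData P} {γ : Fin 2} {s t : Finset P} (h : G.Ag γ s t) :
    G.lowI γ s = G.lowI γ t := by
  ext x
  rw [mem_low, mem_low]
  constructor
  · rintro ⟨y, h1, h2, h3⟩; exact ⟨y, (h y h2).1 h1, h2, h3⟩
  · rintro ⟨y, h1, h2, h3⟩; exact ⟨y, (h y h2).2 h1, h2, h3⟩

lemma high_congr {G : GridData P} {γ : Fin 2} {s t : Finset P} (h : G.Ag γ s t) :
    G.highI γ s = G.highI γ t := by
  ext x
  rw [mem_high, mem_high]
  exact ⟨fun H y h1 h2 => (h y h2).1 (H y h1 h2), fun H y h1 h2 => (h y h2).2 (H y h1 h2)⟩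

lemma low_ideal (G : GridData P) (γ : Fin 2) (t : Finset P) : IsIdeal (G.lowI γ t) := by
  intro x hx y hy
  rw [mem_low] at hx ⊢
  obtain ⟨w, h1, h2, h3⟩ := hx
  exact ⟨w, h1, h2, hy.trans h3⟩

lemma high_ideal (G : GridData P) (γ : Fin 2) (t : Finset P) : IsIdeal (G.highI γ t) := by
  intro x hx y hy
  rw [mem_high] at hx ⊢
  exact fun w h1 h2 => hx w (h1.trans hy) h2

lemma low_sub {G : GridData P} {γ : Fin 2} {t : Finset P} (ht : IsIdeal t) :
    G.lowI γ t ⊆ t := by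
  intro x hx
  rw [mem_low] at hx
  obtain ⟨w, h1, h2, h3⟩ := hx
  exact ht h1 h3

lemma sub_high {G : GridData P} {γ : Fin 2} {t : Finset P} (ht : IsIdeal t) :
    t ⊆ G.highI γ t := by
  intro x hx
  rw [mem_high]
  exact fun y h1 _ => ht hx h1

lemma ag_low {G : GridData P} {γ : Fin 2} {t : Finset P} (ht : IsIdeal t) :
    G.Ag γ (G.lowI γ t) t :=
  fun x hx => ⟨fun h => low_sub ht h, fun h => mem_low.2 ⟨x, h, hx, le_rfl⟩⟩

lemma ag_high {G : GridData P} {γ : Fin 2} {t : Finset P} (ht : IsIdeal t) :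
    G.Ag γ (G.highI γ t) t :=
  fun x hx => ⟨fun h => mem_high.1 h x le_rfl hx, fun h => sub_high ht h⟩

lemma up_steps (G : GridData P) (γ : Fin 2) (n : ℕ) :
    ∀ s u : Finset P, IsIdeal s → IsIdeal u → s ⊆ u → G.Ag γ s u → u.card = s.card + n →
      Relation.ReflTransGen (G.GStep γ) s u ∧ Relation.ReflTransGen (G.GStep γ) u s ∧
      ∀ M, G.MStructured M → G.wt u = G.wt s + (n : ℤ) • M γ := by
  induction n with
  | zero =>
    intro s u hs hu hsu hag hc
    have : s = u := Finset.eq_of_subset_of_card_le hsu (by omega)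
    subst this
    exact ⟨.refl, .refl, by simp⟩
  | succ n ih =>
    intro s u hs hu hsu hag hc
    have hne : (u \ s).Nonempty := by
      rw [← Finset.card_pos, Finset.card_sdiff_of_subset hsu]; omega
    obtain ⟨x, hx⟩ := (u \ s).exists_minimal hne
    have hxu : x ∈ u := (Finset.mem_sdiff.1 hx.1).1
    have hxs : x ∉ s := (Finset.mem_sdiff.1 hx.1).2
    have hcol : G.color x = γ := by
      by_contra h
      exact hxs ((hag x h).2 hxu)
    have hi : IsIdeal (insert x s) := by
      intro y hy w hw
      rcases Finset.mem_insert.1 hy with rfl | hy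
      · by_contra hws
        have hws' : w ≠ y ∧ w ∉ s := by simpa using hws
        have := hx.2 (Finset.mem_sdiff.2 ⟨hu hxu hw, hws'.2⟩) hw
        exact hws'.1 (le_antisymm hw this)
      · exact Finset.mem_insert_of_mem (hs hy hw)
    have hst : G.GStep γ s (insert x s) := ⟨hs, hi, x, hcol, Or.inl ⟨hxs, rfl⟩⟩
    have hst' : G.GStep γ (insert x s) s := ⟨hi, hs, x, hcol, Or.inr ⟨hxs, rfl⟩⟩
    obtain ⟨h1, h2, h3⟩ := ih (insert x s) u hi hu (Finset.insert_subset hxu hsu)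
      (by
        intro y hy
        have : y ≠ x := fun h => hy (h ▸ hcol)
        simp [this, hag y hy])
      (by rw [Finset.card_insert_of_notMem hxs]; omega)
    refine ⟨.head hst h1, h2.tail hst', fun M hM => ?_⟩
    have := hM s _ hs hi x hxs rfl
    rw [h3 M hM, ← this, hcol]
    push_cast
    rw [add_smul, one_smul]
    abel

lemma up_steps' {G : GridData P} {γ : Fin 2} {s u : Finset P} (hs : IsIdeal s) (hu : IsIdeal u)
    (hsu : s ⊆ u) (hag : G.Ag γ s u) :
    Relation.ReflTransGen (G.GStep γ) s u ∧ Relation.ReflTransGen (G.GStep γ) u s ∧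
      ∀ M, G.MStructured M → G.wt u = G.wt s + ((u.card : ℤ) - s.card) • M γ := by
  have h := Finset.card_le_card hsu
  have := up_steps G γ (u.card - s.card) s u hs hu hsu hag (by omega)
  rwa [Nat.cast_sub h] at this

lemma Ag.symm {G : GridData P} {γ : Fin 2} {s t : Finset P} (h : G.Ag γ s t) : G.Ag γ t s :=
  fun x hx => (h x hx).symm

lemma Ag.trans {G : GridData P} {γ : Fin 2} {s t u : Finset P} (h : G.Ag γ s t)
    (h' : G.Ag γ t u) : G.Ag γ s u :=
  fun x hx => (h x hx).trans (h' x hx)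

lemma wt_ag {G : GridData P} {γ : Fin 2} {s t : Finset P} (hs : IsIdeal s) (ht : IsIdeal t)
    (hag : G.Ag γ s t) {M} (hM : G.MStructured M) :
    G.wt s = G.wt t + ((s.card : ℤ) - t.card) • M γ := by
  have h1 := (up_steps' (low_ideal G γ s) hs (low_sub hs) (ag_low hs)).2.2 M hM
  have h2 := (up_steps' (low_ideal G γ t) ht (low_sub ht) (ag_low ht)).2.2 M hM
  rw [low_congr hag] at h1
  rw [h1, h2, add_assoc, ← add_smul]
  congr 2
  ring

lemma comp_ag {G : GridData P} {γ : Fin 2} {s t : Finset P} (ht : IsIdeal t)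
    (h : s ∈ G.comp γ t) : IsIdeal s ∧ G.Ag γ s t := by
  change Relation.ReflTransGen (G.GStep γ) t s at h
  induction h with
  | refl => exact ⟨ht, fun x _ => Iff.rfl⟩
  | tail _ hst ih =>
    obtain ⟨h1, h2, u, hu, h3⟩ := hst
    refine ⟨h2, Ag.trans ?_ ih.2⟩
    intro x hx
    have : x ≠ u := fun h => hx (h ▸ hu)
    rcases h3 with ⟨_, rfl⟩ | ⟨_, rfl⟩ <;> simp [this]

lemma mcoord_eq {G : GridData P} {γ : Fin 2} {t : Finset P} (ht : IsIdeal t) :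
    G.mcoord γ t = 2 * (t.card : ℤ) - (G.lowI γ t).card - (G.highI γ t).card := by
  have hmin : G.minCard γ t = (G.lowI γ t).card := by
    apply IsLeast.csInf_eq
    constructor
    · exact ⟨_, (up_steps' (low_ideal G γ t) ht (low_sub ht) (ag_low ht)).2.1, rfl⟩
    · rintro _ ⟨s, hs, rfl⟩
      obtain ⟨h1, h2⟩ := comp_ag ht hs
      rw [← low_congr h2]
      exact Finset.card_le_card (low_sub h1)
  have hmax : G.maxCard γ t = (G.highI γ t).card := by
    apply IsGreatest.csSup_eq
    constructor
    · exact ⟨_, (up_steps' ht (high_ideal G γ t) (sub_high ht) (ag_high ht).symm).1, rfl⟩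
    · rintro _ ⟨s, hs, rfl⟩
      obtain ⟨h1, h2⟩ := comp_ag ht hs
      rw [← high_congr h2]
      exact Finset.card_le_card (sub_high h1)
  rw [mcoord, hmin, hmax]
  ring

lemma wt_apply (G : GridData P) (γ : Fin 2) (t : Finset P) : G.wt t γ = G.mcoord γ t := by
  fin_cases γ <;> rfl

lemma le_refl_cov {u v : P} (h : u ≤ v) : Relation.ReflTransGen (· ⋖ ·) u v := by
  let _ : LocallyFiniteOrder P := Fintype.toLocallyFiniteOrder
  exact le_iff_reflTransGen_covBy.1 h

lemma chain_anti {G : GridData P} (hG : G.IsTwoColorGridPoset) {u v : P} (h : u ≤ v) :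
    G.chain v ≤ G.chain u := by
  have := le_refl_cov h
  induction this with
  | refl => exact le_rfl
  | tail h1 h2 ih =>
    have h3 := hG.1.2.2.2.2 _ _ h2
    have := ih (by let _ : LocallyFiniteOrder P := Fintype.toLocallyFiniteOrder
                   exact le_iff_reflTransGen_covBy.2 h1)
    omega

lemma chain_const {G : GridData P} (hG : G.IsTwoColorGridPoset) {γ : Fin 2} {u v : P}
    (h : u ≤ v) (hw : ∀ w, u ≤ w → w ≤ v → G.color w = γ) : G.chain u = G.chain v := by
  have := le_refl_cov h
  induction this with
  | refl => rfl
  | @tail b c h1 h2 ih =>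
    have hub : u ≤ b := by
      let _ : LocallyFiniteOrder P := Fintype.toLocallyFiniteOrder
      exact le_iff_reflTransGen_covBy.2 h1
    have e := ih hub (fun w h3 h4 => hw w h3 (h4.trans h2.le))
    rcases hG.1.2.2.2.2 _ _ h2 with h3 | h3
    · omega
    · exact absurd ((hw b hub h2.le).trans (hw c h le_rfl).symm)
        (hG.2.2 b c (.single (Or.inl h2)) h3)

/-- Elements of `high \ low` that are comparable lie in the same chain. -/
lemma chain_D {G : GridData P} (hG : G.IsTwoColorGridPoset) {γ : Fin 2} {t : Finset P} {u v : P}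
    (h : u ≤ v) (hu : u ∉ G.lowI γ t) (hv : v ∈ G.highI γ t) : G.chain u = G.chain v := by
  apply chain_const hG (γ := γ) h
  intro w h1 h2
  by_contra hc
  exact hu (mem_low.2 ⟨w, mem_high.1 hv w h2 hc, hc, h1⟩)

noncomputable def revMap (G : GridData P) (D : Finset P) : P → P :=
  if h : _ then (exists_rev G.chain h D).choose else id

noncomputable def flip (G : GridData P) (γ : Fin 2) (H t : Finset P) : Finset P :=
  G.lowI γ t ∪ ((H \ G.lowI γ t) \ (t \ G.lowI γ t).image (G.revMap (H \ G.lowI γ t)))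

lemma flip_spec {G : GridData P} (hG : G.IsTwoColorGridPoset) {γ : Fin 2} {H t : Finset P}
    (ht : IsIdeal t) (hH : IsIdeal H) (htH : t ⊆ H) (hHh : H ⊆ G.highI γ t) :
    IsIdeal (G.flip γ H t) ∧ G.Ag γ (G.flip γ H t) t ∧ G.flip γ H t ⊆ H ∧
    ((G.flip γ H t).card : ℤ) = H.card + (G.lowI γ t).card - t.card ∧
    G.flip γ H (G.flip γ H t) = t := by
  have hlt := low_sub (γ := γ) (G := G) ht
  set L := G.lowI γ t with hL
  set D := H \ L with hD
  have hφ : ∀ x ∈ D, G.revMap D x ∈ D ∧ G.revMap D (G.revMap D x) = x ∧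
      ∀ y ∈ D, G.chain x = G.chain y → x ≤ y → G.revMap D y ≤ G.revMap D x := by
    rw [revMap, dif_pos hG.1.2.2.2.1]
    exact (exists_rev G.chain hG.1.2.2.2.1 D).choose_spec
  have hflip : G.flip γ H t = L ∪ (D \ (t \ L).image (G.revMap D)) := rfl
  set φ := G.revMap D with hφd
  have htD : t \ L ⊆ D := Finset.sdiff_subset_sdiff htH le_rfl
  have hlH : L ⊆ H := hlt.trans htH
  have hsubD : (t \ L).image φ ⊆ D := by
    intro x hx
    obtain ⟨y, hy, rfl⟩ := Finset.mem_image.1 hx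
    exact (hφ y (htD hy)).1
  have hmem : ∀ x ∈ D, (x ∈ (t \ L).image φ ↔ φ x ∈ t \ L) := by
    intro x hx
    rw [Finset.mem_image]
    constructor
    · rintro ⟨y, hy, rfl⟩
      rwa [(hφ y (htD hy)).2.1]
    · intro h
      exact ⟨φ x, h, (hφ x hx).2.1⟩
  have hDL : ∀ x ∈ D, x ∉ L := fun x hx => (Finset.mem_sdiff.1 hx).2
  have hDH : ∀ x ∈ D, x ∈ H := fun x hx => (Finset.mem_sdiff.1 hx).1
  have hmf : ∀ x ∈ D, (x ∈ G.flip γ H t ↔ φ x ∉ t) := by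
    intro x hx
    rw [hflip, Finset.mem_union, Finset.mem_sdiff, hmem x hx, Finset.mem_sdiff (s := t)]
    have h1 := hDL x hx
    have h2 := hDL _ (hφ x hx).1
    tauto
  have hLf : L ⊆ G.flip γ H t := by rw [hflip]; exact Finset.subset_union_left
  have hfH : G.flip γ H t ⊆ H := by
    rw [hflip]
    exact Finset.union_subset hlH (Finset.sdiff_subset.trans Finset.sdiff_subset)
  have hag : G.Ag γ (G.flip γ H t) t := by
    intro x hx
    constructor
    · intro h
      exact mem_high.1 (hHh (hfH h)) x le_rfl hx
    · intro h
      exact hLf (mem_low.2 ⟨x, h, hx, le_rfl⟩)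
  have hlow : G.lowI γ (G.flip γ H t) = L := low_congr hag
  refine ⟨?_, hag, hfH, ?_, ?_⟩
  · intro x hx y hy
    by_cases hyL : y ∈ L
    · exact hLf hyL
    have hxL : x ∉ L := fun h => hyL (low_ideal G γ t h hy)
    have hxD : x ∈ D := Finset.mem_sdiff.2 ⟨hfH hx, hxL⟩
    have hyD : y ∈ D := Finset.mem_sdiff.2 ⟨hH (hfH hx) hy, hyL⟩
    rw [hmf _ hxD] at hx
    rw [hmf _ hyD]
    intro h
    apply hx
    exact ht h ((hφ y hyD).2.2 x hxD (chain_D hG hy hyL (hHh (hDH x hxD))) hy)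
  · have h1 : ((t \ L).image φ).card = (t \ L).card := by
      apply Finset.card_image_of_injOn
      intro x hx y hy h
      have h3 := (hφ x (htD hx)).2.1
      have h4 := (hφ y (htD hy)).2.1
      rw [← h3, ← h4]
      exact congrArg φ h
    have h2 : Disjoint L (D \ (t \ L).image φ) := by
      rw [Finset.disjoint_left]
      intro x hx hx2
      exact hDL x (Finset.mem_sdiff.1 hx2).1 hx
    rw [hflip, Finset.card_union_of_disjoint h2]
    have h3 := Finset.card_sdiff_add_card_eq_card hsubD
    have h4 := Finset.card_sdiff_add_card_eq_card hlH
    have h5 := Finset.card_sdiff_add_card_eq_card hlt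
    rw [← hD] at h4
    omega
  · ext x
    by_cases hxL : x ∈ L
    · refine ⟨fun _ => hlt hxL, fun _ => ?_⟩
      rw [flip, hlow]
      exact Finset.mem_union_left _ hxL
    by_cases hxH : x ∈ H
    · have hxD : x ∈ D := Finset.mem_sdiff.2 ⟨hxH, hxL⟩
      have hφx := (hφ x hxD).1
      have : G.flip γ H (G.flip γ H t) = L ∪ (D \ (G.flip γ H t \ L).image φ) := by
        conv_lhs => rw [flip, hlow]
      rw [this, Finset.mem_union, Finset.mem_sdiff, Finset.mem_image]
      have key : (∃ a ∈ G.flip γ H t \ L, φ a = x) ↔ x ∉ t := by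
        constructor
        · rintro ⟨a, ha, rfl⟩
          have ha' := Finset.mem_sdiff.1 ha
          have haD : a ∈ D := Finset.mem_sdiff.2 ⟨hfH ha'.1, ha'.2⟩
          exact (hmf a haD).1 ha'.1
        · intro h
          refine ⟨φ x, ?_, (hφ x hxD).2.1⟩
          rw [Finset.mem_sdiff, hmf _ hφx, (hφ x hxD).2.1]
          exact ⟨h, hDL _ hφx⟩
      rw [key]
      tauto
    · refine ⟨fun h => ?_, fun h => absurd (htH h) hxH⟩
      rw [flip, hlow] at h
      exact absurd (Finset.union_subset hlH (Finset.sdiff_subset.trans Finset.sdiff_subset) h) hxH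

/-- `z` is the top of its chain, missing from `t`, and of maximal chain index among missing. -/
def Top (G : GridData P) (γ : Fin 2) (t : Finset P) (z : P) : Prop :=
  z ∉ t ∧ G.color z = γ ∧ (∀ x, x ∉ t → G.chain x ≤ G.chain z) ∧
    ∀ x, G.chain x = G.chain z → x ≤ z

lemma exists_top {G : GridData P} (hG : G.IsTwoColorGridPoset) {t : Finset P} (ht : IsIdeal t)
    {x : P} (hx : x ∉ t) : ∃ z γ, G.Top γ t z ∧ G.chain x ≤ G.chain z := by
  obtain ⟨y, hy, hy2⟩ := Finset.exists_max_image (Finset.univ \ t) G.chain ⟨x, by simpa using hx⟩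
  obtain ⟨z, hz⟩ := (Finset.univ.filter (fun w => G.chain w = G.chain y)).exists_maximal
    ⟨y, by simp⟩
  have hzy : G.chain z = G.chain y := by simpa using hz.1
  have htop : ∀ x, G.chain x = G.chain z → x ≤ z := by
    intro x hx
    rcases hG.1.2.2.2.1 x z hx with h | h
    · exact h
    · exact hz.2 (by simp [hx, hzy]) h
  have hyt : y ∉ t := by simpa using hy
  have hmx : ∀ x, x ∉ t → G.chain x ≤ G.chain z := fun w hw => by
    rw [hzy]; exact hy2 w (by simpa using hw)
  exact ⟨z, G.color z, ⟨fun h => hyt (ht h (htop y hzy.symm)), rfl, hmx, htop⟩, hmx x hx⟩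

lemma top_max {G : GridData P} {z : P}
    (h : ∀ v, ¬ z ⋖ v) : IsMax z := by
  intro b hb
  by_contra hc
  have hlt : z < b := lt_of_le_not_ge hb hc
  let _ : LocallyFiniteOrder P := Fintype.toLocallyFiniteOrder
  obtain ⟨c, hc, _⟩ := exists_covBy_le_of_lt hlt
  exact h c hc

lemma top_unique_aux {G : GridData P} (hG : G.IsTwoColorGridPoset) (hmax : G.MaxProperty)
    {γ : Fin 2} {s t : Finset P} {z z' : P} (hs : IsIdeal s) (hag : G.Ag γ s t)
    (hz : G.Top γ t z) (hz' : G.Top γ s z') : ¬ G.chain z < G.chain z' := by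
  intro hlt
  obtain ⟨a1, a2, a3, a4⟩ := hz
  obtain ⟨b1, b2, b3, b4⟩ := hz'
  have hm' : IsMax z' := by
    apply top_max (G := G)
    intro v hv
    rcases hG.1.2.2.2.2 _ _ hv with h | h
    · exact absurd (b4 v h.symm) (not_le_of_gt hv.lt)
    · have hc := hG.2.2 z' v (.single (Or.inl hv)) h
      rw [b2] at hc
      have hvs : v ∉ s := fun h => b1 (hs h hv.le)
      have hvt : v ∉ t := fun h => hvs ((hag v hc.symm).2 h)
      have := a3 v hvt
      have e : G.chain v = G.chain z := by omega
      exact hc (by rw [hG.2.1 v z e, a2])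
  have h2 := hmax.1 z' hm'
  have hpos : ∀ u, 1 ≤ G.chain u := fun u => (Finset.mem_Icc.1 (hG.1.2.1 u)).1
  have h1 := hpos z
  have hm : IsMax z := by
    apply top_max (G := G)
    intro v hv
    have := hpos v
    rcases hG.1.2.2.2.2 _ _ hv with h | h
    · exact absurd (a4 v h.symm) (not_le_of_gt hv.lt)
    · omega
  exact hmax.2 z z' hm hm' (fun h => by rw [h] at hlt; omega) (a2.trans b2.symm)

lemma top_unique {G : GridData P} (hG : G.IsTwoColorGridPoset) (hmax : G.MaxProperty)
    {γ : Fin 2} {s t : Finset P} {z z' : P} (hs : IsIdeal s) (ht : IsIdeal t) (hag : G.Ag γ s t)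
    (hz : G.Top γ t z) (hz' : G.Top γ s z') : z = z' := by
  have h1 := top_unique_aux hG hmax hs hag hz hz'
  have h2 := top_unique_aux hG hmax ht hag.symm hz' hz
  have e : G.chain z = G.chain z' := by omega
  exact le_antisymm (hz'.2.2.2 z e) (hz.2.2.2 z' e.symm)

lemma top_of_notMem {G : GridData P} (hG : G.IsTwoColorGridPoset) (hmax : G.MaxProperty)
    {γ : Fin 2} {s t : Finset P} {z : P} (hs : IsIdeal s) (ht : IsIdeal t) (hag : G.Ag γ s t)
    (hz : G.Top γ t z) (hzs : z ∉ s) : G.Top γ s z := by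
  obtain ⟨z', γ', hz', hle⟩ := exists_top hG hs hzs
  by_cases hγ : γ' = γ
  · subst hγ
    rwa [top_unique hG hmax hs ht hag hz hz']
  · have h1 : z' ∉ t := fun h => hz'.1 ((hag z' (by rw [hz'.2.1]; exact hγ)).2 h)
    have h2 := hz.2.2.1 z' h1
    have e : G.chain z' = G.chain z := by omega
    exact absurd (hz'.2.1.symm.trans ((hG.2.1 _ _ e).trans hz.2.1)) hγ

lemma top_mem_high {G : GridData P} (hG : G.IsTwoColorGridPoset) {γ : Fin 2} {t : Finset P}
    {z : P} (hz : G.Top γ t z) : z ∈ G.highI γ t := by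
  rw [mem_high]
  intro y hy hc
  by_contra hyt
  have h1 := hz.2.2.1 y hyt
  have h2 := chain_anti hG hy
  exact hc ((hG.2.1 y z (by omega)).trans hz.2.1)

lemma erase_ideal {G : GridData P} (hG : G.IsTwoColorGridPoset) {γ : Fin 2} {t : Finset P}
    (ht : IsIdeal t) {z : P} (hz : G.Top γ t z) : IsIdeal ((G.highI γ t).erase z) := by
  intro x hx y hy
  rw [Finset.mem_erase] at hx ⊢
  refine ⟨?_, high_ideal G γ t hx.2 hy⟩
  rintro rfl
  have := chain_D hG hy (fun h => hz.1 (low_sub ht h)) hx.2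
  exact hx.1 (le_antisymm (hz.2.2.2 x this.symm) hy)

lemma smul_aux (w v : Fin 2 → ℤ) (p q : ℤ) (h : p = -q) : w + p • v = w - q • v := by
  rw [h, neg_smul, sub_eq_add_neg]

/-- Reflection of a weight. -/
def refl (γ : Fin 2) (μ : Fin 2 → ℤ) : Fin 2 → ℤ :=
  μ - μ γ • (!![2, -1; -1, 2] : Matrix (Fin 2) (Fin 2) ℤ) γ

noncomputable def sig (G : GridData P) (γ : Fin 2) (t : Finset P) : Finset P :=
  G.flip γ (G.highI γ t) t

lemma sig_spec {G : GridData P} (hG : G.IsTwoColorGridPoset)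
    (hM : G.MStructured !![2, -1; -1, 2]) {γ : Fin 2} {t : Finset P} (ht : IsIdeal t) :
    IsIdeal (G.sig γ t) ∧ G.sig γ (G.sig γ t) = t ∧ G.wt (G.sig γ t) = refl γ (G.wt t) := by
  obtain ⟨h1, h2, h3, h4, h5⟩ :=
    flip_spec hG ht (high_ideal G γ t) (sub_high ht) (Finset.Subset.refl _)
  refine ⟨h1, ?_, ?_⟩
  · have : G.sig γ (G.sig γ t) = G.flip γ (G.highI γ (G.sig γ t)) (G.sig γ t) := rfl
    rw [this, high_congr (s := G.sig γ t) h2]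
    exact h5
  · have := wt_ag h1 ht h2 hM
    rw [sig, this, refl, wt_apply, mcoord_eq ht, h4]
    exact smul_aux _ _ _ _ (by ring)

noncomputable def tau (G : GridData P) (γ : Fin 2) (t : Finset P) : Finset P :=
  if h : ∃ z, G.Top γ t z then G.flip γ ((G.highI γ t).erase h.choose) t else t

lemma tau_eq {G : GridData P} (hG : G.IsTwoColorGridPoset) (hmax : G.MaxProperty) {γ : Fin 2}
    {t : Finset P} (ht : IsIdeal t) {z : P} (hz : G.Top γ t z) :
    G.tau γ t = G.flip γ ((G.highI γ t).erase z) t := by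
  have h : ∃ z, G.Top γ t z := ⟨z, hz⟩
  rw [tau, dif_pos h, top_unique hG hmax ht ht (fun _ _ => Iff.rfl) h.choose_spec hz]

lemma tau_spec {G : GridData P} (hG : G.IsTwoColorGridPoset) (hmax : G.MaxProperty)
    (hM : G.MStructured !![2, -1; -1, 2]) {γ : Fin 2} {t : Finset P} (ht : IsIdeal t)
    {z : P} (hz : G.Top γ t z) :
    IsIdeal (G.tau γ t) ∧ G.Top γ (G.tau γ t) z ∧ G.tau γ (G.tau γ t) = t ∧
      G.wt (G.tau γ t) + ![1, 1] = refl γ (G.wt t + ![1, 1]) := by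
  have hsub : t ⊆ (G.highI γ t).erase z := by
    intro x hx
    exact Finset.mem_erase.2 ⟨fun h => hz.1 (h ▸ hx), sub_high ht hx⟩
  obtain ⟨h1, h2, h3, h4, h5⟩ :=
    flip_spec hG ht (erase_ideal hG ht hz) hsub (Finset.erase_subset _ _)
  have e := tau_eq hG hmax ht hz
  rw [← e] at h1 h2 h3 h4 h5
  have hz' : G.Top γ (G.tau γ t) z := top_of_notMem hG hmax h1 ht h2 hz
    (fun h => (Finset.mem_erase.1 (h3 h)).1 rfl)
  refine ⟨h1, hz', ?_, ?_⟩
  · rw [tau_eq hG hmax h1 hz', high_congr h2]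
    exact h5
  · have := wt_ag h1 ht h2 hM
    have hc := Finset.card_erase_add_one (top_mem_high hG hz)
    have e1 : (![1, 1] : Fin 2 → ℤ) γ = 1 := by fin_cases γ <;> rfl
    rw [this, refl, Pi.add_apply, wt_apply, mcoord_eq ht, e1, h4, ← hc, add_right_comm]
    exact smul_aux _ _ _ _ (by push_cast; ring)

end GridData

end Helpers

section WeylPart

def refM (γ : Fin 2) : Matrix (Fin 2) (Fin 2) ℤ :=
  if γ = 0 then !![-1, 0; 1, 1] else !![1, 1; 0, -1]

lemma refM_sq (γ : Fin 2) : refM γ * refM γ = 1 := by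
  fin_cases γ <;> decide

lemma refM_det (γ : Fin 2) : (refM γ).det = -1 := by
  fin_cases γ <;> decide

lemma refM_mulVec (γ : Fin 2) (μ : Fin 2 → ℤ) : (refM γ).mulVec μ = GridData.refl γ μ := by
  fin_cases γ <;> ext i <;> fin_cases i <;>
    simp [refM, GridData.refl, Matrix.mulVec, dotProduct, Fin.sum_univ_two] <;> ring

def refU (γ : Fin 2) : (Matrix (Fin 2) (Fin 2) ℤ)ˣ :=
  ⟨refM γ, refM γ, refM_sq γ, refM_sq γ⟩

lemma mem_genSet_iff (w : (Matrix (Fin 2) (Fin 2) ℤ)ˣ) :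
    w ∈ genSet !![-1, 0; 1, 1] !![1, 1; 0, -1] ↔ ∃ γ, w = refU γ := by
  constructor
  · rintro (h | h)
    · exact ⟨0, Units.ext h⟩
    · exact ⟨1, Units.ext h⟩
  · rintro ⟨γ, rfl⟩
    fin_cases γ
    · exact Or.inl rfl
    · exact Or.inr rfl

def weylList : Finset (Matrix (Fin 2) (Fin 2) ℤ) :=
  {!![1, 0; 0, 1], !![-1, 0; 1, 1], !![1, 1; 0, -1], !![-1, -1; 1, 0], !![0, 1; -1, -1],
    !![0, -1; -1, 0]}

lemma weyl_mul : ∀ x ∈ weylList, ∀ y ∈ weylList, x * y ∈ weylList := by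
  decide

lemma weyl_finite : ((Subgroup.closure (genSet !![-1, 0; 1, 1] !![1, 1; 0, -1]) :
    Subgroup (Matrix (Fin 2) (Fin 2) ℤ)ˣ) : Set (Matrix (Fin 2) (Fin 2) ℤ)ˣ).Finite := by
  have key : ∀ w ∈ (Subgroup.closure (genSet !![-1, 0; 1, 1] !![1, 1; 0, -1]) :
      Subgroup (Matrix (Fin 2) (Fin 2) ℤ)ˣ),
      (w : Matrix (Fin 2) (Fin 2) ℤ) ∈ weylList ∧
      ((w⁻¹ : (Matrix (Fin 2) (Fin 2) ℤ)ˣ) : Matrix (Fin 2) (Fin 2) ℤ) ∈ weylList := by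
    intro w hw
    induction hw using Subgroup.closure_induction with
    | mem x hx =>
      obtain ⟨γ, rfl⟩ := (mem_genSet_iff x).1 hx
      change refM γ ∈ weylList ∧ refM γ ∈ weylList
      fin_cases γ <;> decide
    | one => 
      rw [inv_one]
      change (1 : Matrix (Fin 2) (Fin 2) ℤ) ∈ weylList ∧ (1 : Matrix (Fin 2) (Fin 2) ℤ) ∈ weylList
      decide
    | mul x y _ _ hx hy =>
      rw [mul_inv_rev, Units.val_mul, Units.val_mul]
      exact ⟨weyl_mul _ hx.1 _ hy.1, weyl_mul _ hy.2 _ hx.2⟩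
    | inv x _ hx => rw [inv_inv]; exact hx.symm
  refine Set.Finite.of_finite_image (f := Units.val) ?_ Units.val_injective.injOn
  refine weylList.finite_toSet.subset ?_
  rintro _ ⟨w, hw, rfl⟩
  exact (key w hw).1

end WeylPart

theorem stmt_1 {P : Type} [PartialOrder P] [Fintype P] (G : GridData P)
    (hG : G.IsTwoColorGridPoset) (hmax : G.MaxProperty)
    (hM : G.MStructured !![2, -1; -1, 2])
    (a b : ℤ) (ha : a = G.wt Finset.univ 0) (hb : b = G.wt Finset.univ 1)
    (W : Subgroup ((Matrix (Fin 2) (Fin 2) ℤ)ˣ))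
    (hW : W = Subgroup.closure (genSet !![-1, 0; 1, 1] !![1, 1; 0, -1])) :
    (∑ t ∈ Finset.univ.filter (fun t : Finset P => IsIdeal t),
        AddMonoidAlgebra.single (G.wt t) (1 : ℤ)) *
      (∑ᶠ w ∈ (W : Set ((Matrix (Fin 2) (Fin 2) ℤ)ˣ)), AddMonoidAlgebra.single
          ((w : Matrix (Fin 2) (Fin 2) ℤ).mulVec ![1, 1])
          ((w : Matrix (Fin 2) (Fin 2) ℤ).det)) =
    ∑ᶠ w ∈ (W : Set ((Matrix (Fin 2) (Fin 2) ℤ)ˣ)), AddMonoidAlgebra.single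
        ((w : Matrix (Fin 2) (Fin 2) ℤ).mulVec ![a + 1, b + 1])
        ((w : Matrix (Fin 2) (Fin 2) ℤ).det) := by
  have hfin : (W : Set ((Matrix (Fin 2) (Fin 2) ℤ)ˣ)).Finite := by
    rw [hW]; exact weyl_finite
  have hrefW : ∀ γ, refU γ ∈ W := fun γ => by
    rw [hW]; exact Subgroup.subset_closure ((mem_genSet_iff _).2 ⟨γ, rfl⟩)
  set F := hfin.toFinset with hF
  have hmemF : ∀ w, w ∈ F ↔ w ∈ W := by simp [hF]
  rw [finsum_mem_eq_finite_toFinset_sum _ hfin, finsum_mem_eq_finite_toFinset_sum _ hfin, ← hF]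
  set A : (Fin 2 → ℤ) → AddMonoidAlgebra ℤ (Fin 2 → ℤ) := fun μ =>
    ∑ w ∈ F, AddMonoidAlgebra.single
        ((w : Matrix (Fin 2) (Fin 2) ℤ).mulVec μ)
        ((w : Matrix (Fin 2) (Fin 2) ℤ).det) with hA
  set LL := Finset.univ.filter (fun t : Finset P => IsIdeal t) with hLL
  have hmemL : ∀ t, t ∈ LL ↔ IsIdeal t := by simp [hLL]
  -- antisymmetry
  have hanti : ∀ γ μ, A (GridData.refl γ μ) = - A μ := by
    intro γ μ
    rw [hA]
    simp only
    rw [← Finset.sum_neg_distrib]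
    refine Finset.sum_bij' (fun w _ => w * refU γ) (fun w _ => w * refU γ) ?_ ?_ ?_ ?_ ?_
    · intro w hw
      exact (hmemF _).2 (W.mul_mem ((hmemF _).1 hw) (hrefW γ))
    · intro w hw
      exact (hmemF _).2 (W.mul_mem ((hmemF _).1 hw) (hrefW γ))
    · intro w hw
      apply Units.ext
      simp [refU, mul_assoc, refM_sq]
    · intro w hw
      apply Units.ext
      simp [refU, mul_assoc, refM_sq]
    · intro w hw
      rw [← refM_mulVec, Matrix.mulVec_mulVec, Units.val_mul, Matrix.det_mul]
      change _ = - AddMonoidAlgebra.single _ (_ * (refM γ).det)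
      rw [refM_det, mul_neg_one, AddMonoidAlgebra.single_neg, neg_neg]
      rfl
  -- invariance
  have hinv : ∀ w ∈ W, ∃ f g : Finset P → Finset P, ∀ t ∈ LL, f t ∈ LL ∧ g t ∈ LL ∧
      g (f t) = t ∧ f (g t) = t ∧
      G.wt (f t) = (w : Matrix (Fin 2) (Fin 2) ℤ).mulVec (G.wt t) := by
    intro w hw
    rw [hW] at hw
    induction hw using Subgroup.closure_induction with
    | mem x hx =>
      obtain ⟨γ, rfl⟩ := (mem_genSet_iff x).1 hx
      refine ⟨G.sig γ, G.sig γ, fun t ht => ?_⟩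
      obtain ⟨h1, h2, h3⟩ := GridData.sig_spec hG hM (γ := γ) ((hmemL t).1 ht)
      refine ⟨(hmemL _).2 h1, (hmemL _).2 h1, h2, h2, ?_⟩
      rw [h3, ← refM_mulVec]
      rfl
    | one => exact ⟨id, id, fun t ht => ⟨ht, ht, rfl, rfl, by simp⟩⟩
    | mul x y _ _ hx hy =>
      obtain ⟨f, g, h⟩ := hx
      obtain ⟨f', g', h'⟩ := hy
      refine ⟨f ∘ f', g' ∘ g, fun t ht => ?_⟩
      obtain ⟨a1, a2, a3, a4, a5⟩ := h' t ht
      obtain ⟨b1, b2, b3, b4, b5⟩ := h _ a1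
      obtain ⟨c1, c2, c3, c4, c5⟩ := h t ht
      obtain ⟨d1, d2, d3, d4, d5⟩ := h' _ c2
      refine ⟨b1, d2, ?_, ?_, ?_⟩
      · simp [b3, a3]
      · simp [d4, c4]
      · rw [Function.comp_apply, b5, a5, Matrix.mulVec_mulVec, Units.val_mul]
    | inv x _ hx =>
      obtain ⟨f, g, h⟩ := hx
      refine ⟨g, f, fun t ht => ?_⟩
      obtain ⟨c1, c2, c3, c4, c5⟩ := h t ht
      obtain ⟨d1, d2, d3, d4, d5⟩ := h _ c2
      refine ⟨c2, c1, c4, c3, ?_⟩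
      rw [c4] at d5
      rw [d5, Matrix.mulVec_mulVec, Units.inv_mul, Matrix.one_mulVec]
  have hsum : (∑ t ∈ LL, AddMonoidAlgebra.single (G.wt t) (1 : ℤ)) * A ![1, 1] =
      ∑ t ∈ LL, A (G.wt t + ![1, 1]) := by
    rw [hA]
    simp only
    rw [Finset.mul_sum, Finset.sum_comm]
    refine Finset.sum_congr rfl fun w hw => ?_
    obtain ⟨f, g, h⟩ := hinv w ((hmemF w).1 hw)
    rw [Finset.sum_mul]
    symm
    refine Finset.sum_bij' (fun t _ => f t) (fun t _ => g t) ?_ ?_ ?_ ?_ ?_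
    · exact fun t ht => (h t ht).1
    · exact fun t ht => (h t ht).2.1
    · exact fun t ht => (h t ht).2.2.1
    · exact fun t ht => (h t ht).2.2.2.1
    · intro t ht
      rw [(h t ht).2.2.2.2, AddMonoidAlgebra.single_mul_single, one_mul, Matrix.mulVec_add]
  have hzero : ∀ γ, ∑ t ∈ LL.filter (fun t => ∃ z, G.Top γ t z), A (G.wt t + ![1, 1]) = 0 := by
    intro γ
    have : ∑ t ∈ LL.filter (fun t => ∃ z, G.Top γ t z), A (G.wt t + ![1, 1]) =
        ∑ t ∈ LL.filter (fun t => ∃ z, G.Top γ t z), - A (G.wt t + ![1, 1]) := by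
      have hm : ∀ t ∈ LL.filter (fun t => ∃ z, G.Top γ t z),
          G.tau γ t ∈ LL.filter (fun t => ∃ z, G.Top γ t z) ∧ G.tau γ (G.tau γ t) = t ∧
          G.wt (G.tau γ t) + ![1, 1] = GridData.refl γ (G.wt t + ![1, 1]) := by
        intro t ht
        obtain ⟨h1, z, hz⟩ := Finset.mem_filter.1 ht
        obtain ⟨a1, a2, a3, a4⟩ := GridData.tau_spec hG hmax hM ((hmemL t).1 h1) hz
        exact ⟨Finset.mem_filter.2 ⟨(hmemL _).2 a1, z, a2⟩, a3, a4⟩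
      refine Finset.sum_bij' (fun t _ => G.tau γ t) (fun t _ => G.tau γ t) ?_ ?_ ?_ ?_ ?_
      · exact fun t ht => (hm t ht).1
      · exact fun t ht => (hm t ht).1
      · exact fun t ht => (hm t ht).2.1
      · exact fun t ht => (hm t ht).2.1
      · intro t ht
        rw [(hm t ht).2.2, hanti, neg_neg]
    rw [Finset.sum_neg_distrib] at this
    have h2 : (2 : ℤ) • (∑ t ∈ LL.filter (fun t => ∃ z, G.Top γ t z), A (G.wt t + ![1, 1])) = 0 := by
      rw [two_smul]
      nth_rewrite 1 [this]
      exact neg_add_cancel _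
    exact (smul_eq_zero.1 h2).resolve_left (by norm_num)
  have hab : (![a + 1, b + 1] : Fin 2 → ℤ) = G.wt Finset.univ + ![1, 1] := by
    ext i
    fin_cases i <;> simp [ha, hb]
  have hsplit : LL = insert Finset.univ
      (LL.filter (fun t => ∃ z, G.Top 0 t z) ∪ LL.filter (fun t => ∃ z, G.Top 1 t z)) := by
    ext t
    simp only [Finset.mem_insert, Finset.mem_union, Finset.mem_filter]
    constructor
    · intro ht
      by_cases h : t = Finset.univ
      · exact Or.inl h
      · right
        obtain ⟨x, hx⟩ : ∃ x, x ∉ t := by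
          by_contra hc
          push Not at hc
          exact h (Finset.eq_univ_iff_forall.2 hc)
        obtain ⟨z, γ, hz, _⟩ := GridData.exists_top hG ((hmemL t).1 ht) hx
        fin_cases γ
        · exact Or.inl ⟨ht, z, hz⟩
        · exact Or.inr ⟨ht, z, hz⟩
    · rintro (rfl | h | h)
      · exact (hmemL _).2 (fun _ _ _ _ => Finset.mem_univ _)
      · exact h.1
      · exact h.1
  change _ * A ![1, 1] = A ![a + 1, b + 1]
  rw [hsum, hab]
  conv_lhs => rw [hsplit]
  rw [Finset.sum_insert, Finset.sum_union, hzero, hzero, add_zero, add_zero]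
  · rw [Finset.disjoint_left]
    intro t h1 h2
    obtain ⟨_, z, hz⟩ := Finset.mem_filter.1 h1
    obtain ⟨_, z', hz'⟩ := Finset.mem_filter.1 h2
    have e : G.chain z = G.chain z' := le_antisymm (hz'.2.2.1 z hz.1) (hz.2.2.1 z' hz'.1)
    have := hG.2.1 z z' e
    rw [hz.2.1, hz'.2.1] at this
    exact absurd this (by decide)
  · intro h
    simp only [Finset.mem_union, Finset.mem_filter] at h
    rcases h with ⟨_, z, hz⟩ | ⟨_, z, hz⟩ <;> exact hz.1 (Finset.mem_univ z)
end

section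
/- Let P be a two-color grid poset with the max property and let L := J_color(P). Suppose L is M-structured for M = [[2,−1],[−3,2]]. Write (a,b) := wt(max). Let W be the subgroup of GL₂(ℤ) generated by S_α := [[−1,0],[1,1]] and S_β := [[1,3],[0,−1]] (a finite group of order 12). Then in the group ring ℤ[ℤ²]: (Σ_{s∈L} e^{wt(s)}) · (Σ_{w∈W} det(w) e^{w·(1,1)}) = Σ_{w∈W} det(w) e^{w·(a+1,b+1)}. -/
open scoped Classical

namespace GridProof

set_option linter.unusedSectionVars false

variable {P : Type} [PartialOrder P] [Fintype P]

/-- Reflection of an interval of ideals whose difference is a disjoint union of chains. -/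
theorem exists_reflect (chain : P → ℕ)
    (hchain : ∀ u v : P, chain u = chain v → u ≤ v ∨ v ≤ u)
    (B T : Finset P) (hB : IsIdeal B) (hT : IsIdeal T) (hBT : B ⊆ T)
    (hF : ∀ x y, x ∈ T → y ∈ T → x ∉ B → y ∉ B → x ≤ y → chain x = chain y) :
    ∃ φ : Finset P → Finset P, ∀ t, IsIdeal t → B ⊆ t → t ⊆ T →
      IsIdeal (φ t) ∧ B ⊆ φ t ∧ φ t ⊆ T ∧ (φ t).card + t.card = B.card + T.card ∧
      φ (φ t) = t := by
  set F := T \ B with hFdef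
  let Fi : ℕ → Finset P := fun i => F.filter (fun x => chain x = i)
  let r : P → ℕ := fun x => ((Fi (chain x)).filter (fun y => y < x)).card
  have rmono : ∀ x y, x ∈ F → y ∈ F → chain x = chain y → x < y → r x < r y := by
    intro x y hx hy hc hxy
    apply Finset.card_lt_card
    refine ⟨?_, ?_⟩
    · intro a ha
      simp only [Fi, Finset.mem_filter] at ha ⊢
      exact ⟨⟨ha.1.1, ha.1.2.trans hc⟩, ha.2.trans hxy⟩
    · intro h
      have : x ∈ (Fi (chain x)).filter (fun y => y < x) := by
        apply h
        simp only [Fi, Finset.mem_filter]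
        exact ⟨⟨hx, hc⟩, hxy⟩
      simp at this
  have rinj : ∀ x y, x ∈ F → y ∈ F → chain x = chain y → r x = r y → x = y := by
    intro x y hx hy hc h
    by_contra hne
    rcases hchain x y hc with h1 | h1
    · have := rmono x y hx hy hc (lt_of_le_of_ne h1 hne); omega
    · have := rmono y x hy hx hc.symm (lt_of_le_of_ne h1 (Ne.symm hne)); omega
  have rlt : ∀ x, x ∈ F → r x < (Fi (chain x)).card := by
    intro x hx
    apply Finset.card_lt_card
    refine ⟨Finset.filter_subset _ _, ?_⟩
    intro h
    have : x ∈ (Fi (chain x)).filter (fun y => y < x) := by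
      apply h
      exact Finset.mem_filter.2 ⟨hx, rfl⟩
    simp at this
  have hs : ∀ x, ∃ y, x ∈ F → y ∈ F ∧ chain y = chain x ∧
      r x + r y + 1 = (Fi (chain x)).card := by
    intro x
    by_cases hx : x ∈ F
    · have himg : (Fi (chain x)).image r = Finset.range (Fi (chain x)).card := by
        apply Finset.eq_of_subset_of_card_le
        · intro a ha
          obtain ⟨y, hy, rfl⟩ := Finset.mem_image.1 ha
          simp only [Fi, Finset.mem_filter] at hy
          have := rlt y hy.1
          rw [hy.2] at this
          exact Finset.mem_range.2 this
        · rw [Finset.card_image_of_injOn, Finset.card_range]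
          intro a ha b hb hab
          simp only [Fi, Finset.coe_filter, Set.mem_ofPred_eq] at ha hb
          exact rinj a b ha.1 hb.1 (ha.2.trans hb.2.symm) hab
      have hl := rlt x hx
      have : (Fi (chain x)).card - 1 - r x ∈ (Fi (chain x)).image r := by
        rw [himg, Finset.mem_range]; omega
      obtain ⟨y, hy, hyr⟩ := Finset.mem_image.1 this
      simp only [Fi, Finset.mem_filter] at hy
      refine ⟨y, fun _ => ⟨hy.1, hy.2, ?_⟩⟩
      omega
    · exact ⟨x, fun h => absurd h hx⟩
  choose σ hσ using hs
  have hσσ : ∀ x ∈ F, σ (σ x) = x := by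
    intro x hx
    obtain ⟨h1, h2, h3⟩ := hσ x hx
    obtain ⟨h4, h5, h6⟩ := hσ _ h1
    apply rinj _ _ h4 hx (h5.trans h2)
    rw [h2] at h6
    omega
  have hanti : ∀ x y, x ∈ F → y ∈ F → x ≤ y → σ y ≤ σ x := by
    intro x y hx hy hxy
    obtain ⟨h1, h2, h3⟩ := hσ x hx
    obtain ⟨h4, h5, h6⟩ := hσ y hy
    have hc : chain x = chain y := by
      simp only [hFdef, Finset.mem_sdiff] at hx hy
      exact hF x y hx.1 hy.1 hx.2 hy.2 hxy
    rcases eq_or_lt_of_le hxy with rfl | hlt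
    · exact le_rfl
    have := rmono x y hx hy hc hlt
    rcases hchain (σ y) (σ x) (by rw [h2, h5, hc]) with h | h
    · exact h
    · rcases eq_or_lt_of_le h with h | h
      · exact h.symm.le
      · have := rmono _ _ h1 h4 (by rw [h2, h5, hc]) h
        rw [hc] at h3
        omega
  refine ⟨fun t => B ∪ F.filter (fun x => σ x ∉ t), ?_⟩
  intro t ht hBt htT
  have memF : ∀ x, x ∈ F ↔ x ∈ T ∧ x ∉ B := by intro x; simp [hFdef]
  refine ⟨?_, Finset.subset_union_left, ?_, ?_, ?_⟩
  · intro x hx y hyx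
    rw [Finset.mem_union, Finset.mem_filter] at hx ⊢
    rcases hx with hx | ⟨hx, hxt⟩
    · exact Or.inl (hB hx hyx)
    · by_cases hyB : y ∈ B
      · exact Or.inl hyB
      · have hyF : y ∈ F := (memF y).2 ⟨hT ((memF x).1 hx).1 hyx, hyB⟩
        exact Or.inr ⟨hyF, fun h => hxt (ht h (hanti y x hyF hx hyx))⟩
  · intro x hx
    rw [Finset.mem_union, Finset.mem_filter] at hx
    rcases hx with hx | hx
    · exact hBT hx
    · exact ((memF x).1 hx.1).1
  · have h1 : (B ∪ F.filter (fun x => σ x ∉ t)).card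
        = B.card + (F.filter (fun x => σ x ∉ t)).card := by
      apply Finset.card_union_of_disjoint
      rw [Finset.disjoint_left]
      intro x hx hx'
      exact ((memF x).1 (Finset.mem_filter.1 hx').1).2 hx
    have h2 : (F.filter (fun x => σ x ∉ t)).card = (T \ t).card := by
      apply Finset.card_nbij' σ σ
      · intro x hx
        simp only [Finset.coe_filter, Set.mem_ofPred_eq] at hx
        simp only [Finset.mem_coe, Finset.mem_sdiff]
        exact ⟨((memF _).1 (hσ x hx.1).1).1, hx.2⟩
      · intro x hx
        simp only [Finset.mem_coe, Finset.mem_sdiff] at hx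
        have hxF : x ∈ F := (memF x).2 ⟨hx.1, fun h => hx.2 (hBt h)⟩
        simp only [Finset.coe_filter, Set.mem_ofPred_eq]
        rw [hσσ x hxF]
        exact ⟨(hσ x hxF).1, hx.2⟩
      · intro x hx
        simp only [Finset.coe_filter, Set.mem_ofPred_eq] at hx
        exact hσσ x hx.1
      · intro x hx
        simp only [Finset.mem_coe, Finset.mem_sdiff] at hx
        have hxF : x ∈ F := (memF x).2 ⟨hx.1, fun h => hx.2 (hBt h)⟩
        exact hσσ x hxF
    have h3 := Finset.card_sdiff_add_card_eq_card htT
    dsimp only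
    omega
  · ext x
    by_cases hxB : x ∈ B
    · simp [hxB, hBt hxB]
    · by_cases hxF : x ∈ F
      · have h1 := (hσ x hxF).1
        have h2 := hσσ x hxF
        have h3 := ((memF _).1 h1).2
        simp [hxB, hxF, h1, h2, h3]
      · have : x ∉ t := fun h => hxF ((memF x).2 ⟨htT h, hxB⟩)
        simp [hxB, hxF, this]

/-- Two ideals agree away from color `γ`. -/
def Agree (G : GridData P) (γ : Fin 2) (s t : Finset P) : Prop :=
  ∀ x, G.color x ≠ γ → (x ∈ s ↔ x ∈ t)

/-- The largest ideal of a monochromatic component. -/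
noncomputable def topI (G : GridData P) (γ : Fin 2) (t : Finset P) : Finset P :=
  Finset.univ.filter (fun x => ∀ y, y ≤ x → G.color y ≠ γ → y ∈ t)

/-- The smallest ideal of a monochromatic component. -/
noncomputable def botI (G : GridData P) (γ : Fin 2) (t : Finset P) : Finset P :=
  Finset.univ.filter (fun x => ∃ y, x ≤ y ∧ G.color y ≠ γ ∧ y ∈ t)

theorem Agree.symm {G : GridData P} {γ : Fin 2} {s t : Finset P} (h : Agree G γ s t) :
    Agree G γ t s := fun x hx => (h x hx).symm

theorem Agree.trans {G : GridData P} {γ : Fin 2} {s t u : Finset P} (h : Agree G γ s t)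
    (h' : Agree G γ t u) : Agree G γ s u := fun x hx => (h x hx).trans (h' x hx)

theorem mem_topI {G : GridData P} {γ : Fin 2} {t : Finset P} {x : P} :
    x ∈ topI G γ t ↔ ∀ y, y ≤ x → G.color y ≠ γ → y ∈ t := by simp [topI]

theorem mem_botI {G : GridData P} {γ : Fin 2} {t : Finset P} {x : P} :
    x ∈ botI G γ t ↔ ∃ y, x ≤ y ∧ G.color y ≠ γ ∧ y ∈ t := by simp [botI]

theorem isIdeal_topI (G : GridData P) (γ : Fin 2) (t : Finset P) : IsIdeal (topI G γ t) := by
  intro x hx y hyx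
  rw [mem_topI] at hx ⊢
  exact fun z hz => hx z (hz.trans hyx)

theorem isIdeal_botI (G : GridData P) (γ : Fin 2) (t : Finset P) : IsIdeal (botI G γ t) := by
  intro x hx y hyx
  rw [mem_botI] at hx ⊢
  obtain ⟨z, hz, h⟩ := hx
  exact ⟨z, hyx.trans hz, h⟩

theorem topI_congr {G : GridData P} {γ : Fin 2} {s t : Finset P} (h : Agree G γ s t) :
    topI G γ s = topI G γ t := by
  ext x
  simp only [mem_topI]
  exact ⟨fun H y hy hc => (h y hc).1 (H y hy hc), fun H y hy hc => (h y hc).2 (H y hy hc)⟩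

theorem botI_congr {G : GridData P} {γ : Fin 2} {s t : Finset P} (h : Agree G γ s t) :
    botI G γ s = botI G γ t := by
  ext x
  simp only [mem_botI]
  exact ⟨fun ⟨y, hy, hc, H⟩ => ⟨y, hy, hc, (h y hc).1 H⟩,
    fun ⟨y, hy, hc, H⟩ => ⟨y, hy, hc, (h y hc).2 H⟩⟩

theorem subset_topI {G : GridData P} {γ : Fin 2} {t : Finset P} (ht : IsIdeal t) :
    t ⊆ topI G γ t := fun _ hx => mem_topI.2 fun _ hy _ => ht hx hy

theorem botI_subset {G : GridData P} {γ : Fin 2} {t : Finset P} (ht : IsIdeal t) :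
    botI G γ t ⊆ t := by
  intro x hx
  obtain ⟨y, hy, _, h⟩ := mem_botI.1 hx
  exact ht h hy

theorem agree_of_between {G : GridData P} {γ : Fin 2} {s t : Finset P}
    (h1 : botI G γ t ⊆ s) (h2 : s ⊆ topI G γ t) : Agree G γ s t := by
  intro x hx
  refine ⟨fun h => mem_topI.1 (h2 h) x le_rfl hx, fun h => h1 (mem_botI.2 ⟨x, le_rfl, hx, h⟩)⟩

theorem gstep_symm {G : GridData P} {γ : Fin 2} {s t : Finset P} (h : G.GStep γ s t) :
    G.GStep γ t s := by
  obtain ⟨h1, h2, u, hu, h⟩ := h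
  exact ⟨h2, h1, u, hu, h.symm⟩

theorem reach_up {G : GridData P} {γ : Fin 2} (n : ℕ) : ∀ {s t : Finset P}, IsIdeal s → IsIdeal t →
    s ⊆ t → Agree G γ s t → (t \ s).card = n → Relation.ReflTransGen (G.GStep γ) s t := by
  induction n with
  | zero =>
    intro s t _ _ hst _ hn
    have : t ⊆ s := by simpa [Finset.sdiff_eq_empty_iff_subset] using hn
    rw [Finset.Subset.antisymm hst this]
  | succ n ih =>
    intro s t hs ht hst hag hn
    have hne : (t \ s).Nonempty := by rw [← Finset.card_pos]; omega
    obtain ⟨u, hu, hmin⟩ := Finset.exists_minimal hne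
    have hu' := Finset.mem_sdiff.1 hu
    have hcol : G.color u = γ := by
      by_contra hc
      exact hu'.2 ((hag u hc).2 hu'.1)
    have hid : IsIdeal (insert u s) := by
      intro x hx y hyx
      rcases Finset.mem_insert.1 hx with rfl | hx
      · by_cases hy : y ∈ s
        · exact Finset.mem_insert_of_mem hy
        · have := hmin (Finset.mem_sdiff.2 ⟨ht hu'.1 hyx, hy⟩) hyx
          rw [le_antisymm hyx this]
          exact Finset.mem_insert_self _ _
      · exact Finset.mem_insert_of_mem (hs hx hyx)
    have hstep : G.GStep γ s (insert u s) := ⟨hs, hid, u, hcol, Or.inl ⟨hu'.2, rfl⟩⟩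
    refine Relation.ReflTransGen.head hstep (ih hid ht ?_ ?_ ?_)
    · exact Finset.insert_subset hu'.1 hst
    · intro x hx
      rw [Finset.mem_insert, ← hag x hx]
      refine ⟨fun h => h.resolve_left ?_, Or.inr⟩
      rintro rfl
      exact hx hcol
    · have : t \ insert u s = (t \ s).erase u := by
        ext x; simp only [Finset.mem_sdiff, Finset.mem_insert, Finset.mem_erase]; tauto
      rw [this, Finset.card_erase_of_mem hu]; omega

theorem mem_comp_iff {G : GridData P} {γ : Fin 2} {s t : Finset P} (ht : IsIdeal t) :
    s ∈ G.comp γ t ↔ IsIdeal s ∧ Agree G γ s t := by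
  constructor
  · intro h
    change Relation.ReflTransGen (G.GStep γ) t s at h
    induction h with
    | refl => exact ⟨ht, fun _ _ => Iff.rfl⟩
    | tail _ hst ih =>
      obtain ⟨h1, h2, u, hu, h⟩ := hst
      refine ⟨h2, Agree.trans ?_ ih.2⟩
      intro x hx
      have hxu : x ≠ u := by rintro rfl; exact hx hu
      rcases h with ⟨_, rfl⟩ | ⟨_, rfl⟩ <;> simp [hxu]
  · rintro ⟨hs, hag⟩
    have hid : IsIdeal (s ∪ t) := by
      intro x hx y hyx
      rw [Finset.mem_union] at hx ⊢
      exact hx.imp (fun h => hs h hyx) (fun h => ht h hyx)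
    have a1 : Agree G γ t (s ∪ t) := by
      intro x hx
      rw [Finset.mem_union, hag x hx]; tauto
    have r1 := reach_up _ ht hid Finset.subset_union_right a1 rfl
    have r2 := reach_up _ hs hid Finset.subset_union_left (hag.trans a1) rfl
    have r3 : Relation.ReflTransGen (G.GStep γ) (s ∪ t) s :=
      have : Std.Symm (G.GStep γ) := ⟨fun _ _ h => gstep_symm h⟩
      Relation.ReflTransGen.stdSymm.symm _ _ r2
    exact r1.trans r3

theorem mcoord_eq {G : GridData P} {γ : Fin 2} {t : Finset P} (ht : IsIdeal t) :
    G.mcoord γ t = 2 * (t.card : ℤ) - (botI G γ t).card - (topI G γ t).card := by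
  have hbt : botI G γ t ⊆ topI G γ t := (botI_subset ht).trans (subset_topI ht)
  have h1 : G.minCard γ t = (botI G γ t).card := by
    apply IsLeast.csInf_eq
    constructor
    · exact ⟨_, (mem_comp_iff ht).2 ⟨isIdeal_botI _ _ _, agree_of_between subset_rfl hbt⟩, rfl⟩
    · rintro _ ⟨s, hs, rfl⟩
      obtain ⟨h1, h2⟩ := (mem_comp_iff ht).1 hs
      rw [← botI_congr h2]
      exact Finset.card_le_card (botI_subset h1)
  have h2 : G.maxCard γ t = (topI G γ t).card := by
    apply IsGreatest.csSup_eq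
    constructor
    · exact ⟨_, (mem_comp_iff ht).2 ⟨isIdeal_topI _ _ _, agree_of_between hbt subset_rfl⟩, rfl⟩
    · rintro _ ⟨s, hs, rfl⟩
      obtain ⟨h1, h2⟩ := (mem_comp_iff ht).1 hs
      rw [← topI_congr h2]
      exact Finset.card_le_card (subset_topI h1)
  rw [GridData.mcoord, h1, h2]; ring

theorem wt_of_agree {G : GridData P} {γ : Fin 2} {M : Matrix (Fin 2) (Fin 2) ℤ}
    (hM : G.MStructured M) {s t : Finset P} (hs : IsIdeal s) (ht : IsIdeal t)
    (h : Agree G γ s t) : G.wt s = G.wt t + ((s.card : ℤ) - t.card) • M γ := by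
  have hr : s ∈ G.comp γ t := (mem_comp_iff ht).2 ⟨hs, h⟩
  change Relation.ReflTransGen (G.GStep γ) t s at hr
  clear h hs
  induction hr with
  | refl => simp
  | tail _ hst ih =>
    obtain ⟨h1, h2, u, hu, h⟩ := hst
    rcases h with ⟨hn, he⟩ | ⟨hn, he⟩
    · have := hM _ _ h1 h2 u hn he
      rw [← this, ih, hu, he, Finset.card_insert_of_notMem hn]
      push_cast
      module
    · have := hM _ _ h2 h1 u hn he
      rw [ih, hu, he, Finset.card_insert_of_notMem hn] at this
      rw [eq_sub_of_add_eq this]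
      push_cast
      module

theorem wt_apply (G : GridData P) (γ : Fin 2) (t : Finset P) : G.wt t γ = G.mcoord γ t := by
  fin_cases γ <;> rfl

theorem exists_mid {G : GridData P} (hG : G.IsTwoColorGridPoset) (v : P) : ∀ u : P, u < v →
    G.color u = G.color v → G.chain u ≠ G.chain v →
    ∃ w, u < w ∧ w < v ∧ G.color w ≠ G.color u := by
  intro u
  induction u using (wellFounded_gt (α := P)).induction with
  | _ u ih =>
  intro huv hc hch
  obtain ⟨x, hux, hxv⟩ := exists_covBy_le_of_lt huv
  rcases hG.1.2.2.2.2 u x hux with h | h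
  · have hcx : G.color u = G.color x := hG.2.1 _ _ h
    have hne : x ≠ v := by rintro rfl; exact hch h
    obtain ⟨w, h1, h2, h3⟩ := ih x hux.lt (lt_of_le_of_ne hxv hne) (hcx ▸ hc) (h ▸ hch)
    exact ⟨w, hux.lt.trans h1, h2, hcx ▸ h3⟩
  · have hcx : G.color u ≠ G.color x := hG.2.2 u x (Relation.ReflTransGen.single (Or.inl hux)) h
    have hne : x ≠ v := by rintro rfl; exact hcx hc
    exact ⟨x, hux.lt, lt_of_le_of_ne hxv hne, hcx.symm⟩

theorem free_chain {G : GridData P} (hG : G.IsTwoColorGridPoset) {γ : Fin 2} {t : Finset P}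
    (x y : P) (hx : x ∈ topI G γ t) (hy : y ∈ topI G γ t) (hx' : x ∉ botI G γ t)
    (hy' : y ∉ botI G γ t) (hxy : x ≤ y) : G.chain x = G.chain y := by
  have hcol : ∀ z, z ∈ topI G γ t → z ∉ botI G γ t → G.color z = γ := by
    intro z h1 h2
    by_contra hc
    exact h2 (mem_botI.2 ⟨z, le_rfl, hc, mem_topI.1 h1 z le_rfl hc⟩)
  by_contra hch
  have hcx := hcol x hx hx'
  have hcy := hcol y hy hy'
  have hne : x ≠ y := by rintro rfl; exact hch rfl
  obtain ⟨w, h1, h2, h3⟩ := exists_mid hG y x (lt_of_le_of_ne hxy hne) (hcx.trans hcy.symm) hch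
  rw [hcx] at h3
  exact hx' (mem_botI.2 ⟨w, h1.le, h3, mem_topI.1 hy w h2.le h3⟩)

/-- A chosen reflection of the interval from `B` to `T`. -/
noncomputable def refl (B T : Finset P) : Finset P → Finset P :=
  if h : ∃ φ : Finset P → Finset P, ∀ t, IsIdeal t → B ⊆ t → t ⊆ T →
      IsIdeal (φ t) ∧ B ⊆ φ t ∧ φ t ⊆ T ∧ (φ t).card + t.card = B.card + T.card ∧
      φ (φ t) = t then h.choose else id

theorem refl_spec {G : GridData P} (hG : G.IsTwoColorGridPoset)
    {B T : Finset P} (hB : IsIdeal B) (hT : IsIdeal T) (hBT : B ⊆ T)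
    (hF : ∀ x y, x ∈ T → y ∈ T → x ∉ B → y ∉ B → x ≤ y → G.chain x = G.chain y)
    {t : Finset P} (ht : IsIdeal t) (h1 : B ⊆ t) (h2 : t ⊆ T) :
    IsIdeal (refl B T t) ∧ B ⊆ refl B T t ∧ refl B T t ⊆ T ∧
      (refl B T t).card + t.card = B.card + T.card ∧ refl B T (refl B T t) = t := by
  have h := exists_reflect G.chain hG.1.2.2.2.1 B T hB hT hBT hF
  rw [refl, dif_pos h]
  exact h.choose_spec t ht h1 h2

/-- The reflection matrix of color `γ`. -/
def Smat (γ : Fin 2) : Matrix (Fin 2) (Fin 2) ℤ :=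
  if γ = 0 then !![-1, 0; 1, 1] else !![1, 3; 0, -1]

theorem Smat_mulVec (γ : Fin 2) (v : Fin 2 → ℤ) :
    (Smat γ).mulVec v = v - (v γ) • (!![2, -1; -3, 2] : Matrix (Fin 2) (Fin 2) ℤ) γ := by
  funext i
  fin_cases γ <;> fin_cases i <;>
    simp [Smat, Matrix.mulVec, dotProduct, Fin.sum_univ_two] <;> ring

theorem exists_inv1 {G : GridData P} (hG : G.IsTwoColorGridPoset)
    (hM : G.MStructured !![2, -1; -3, 2]) (γ : Fin 2) :
    ∃ φ : Finset P → Finset P, ∀ t, IsIdeal t → IsIdeal (φ t) ∧ φ (φ t) = t ∧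
      G.wt (φ t) = (Smat γ).mulVec (G.wt t) := by
  refine ⟨fun t => refl (botI G γ t) (topI G γ t) t, ?_⟩
  intro t ht
  obtain ⟨h1, h2, h3, h4, h5⟩ := refl_spec hG (isIdeal_botI G γ t) (isIdeal_topI G γ t)
    ((botI_subset ht).trans (subset_topI ht)) (free_chain hG) ht (botI_subset ht) (subset_topI ht)
  have hag := agree_of_between h2 h3
  refine ⟨h1, ?_, ?_⟩
  · dsimp only
    rw [botI_congr hag, topI_congr hag, h5]
  · dsimp only
    rw [wt_of_agree hM h1 ht hag, Smat_mulVec, wt_apply, mcoord_eq ht]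
    have e : (2 * (t.card : ℤ) - (botI G γ t).card - (topI G γ t).card)
        = -(((refl (botI G γ t) (topI G γ t) t).card : ℤ) - t.card) := by omega
    rw [e]
    module

end GridProof

namespace GridProof

variable {P : Type} [PartialOrder P] [Fintype P]

/-- The vertex `z` is missing from `t` but belongs to the top of its component. -/
def Good (G : GridData P) (t : Finset P) (z : P) : Prop :=
  z ∉ t ∧ ∀ y, y ≤ z → G.color y ≠ G.color z → y ∈ t

theorem chain_anti {G : GridData P} (hG : G.IsTwoColorGridPoset) (v : P) : ∀ u : P, u ≤ v →
    G.chain v ≤ G.chain u := by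
  intro u
  induction u using (wellFounded_gt (α := P)).induction with
  | _ u ih =>
  intro huv
  rcases eq_or_lt_of_le huv with rfl | huv
  · exact le_rfl
  obtain ⟨x, hux, hxv⟩ := exists_covBy_le_of_lt huv
  have := ih x hux.lt hxv
  rcases hG.1.2.2.2.2 u x hux with h | h <;> omega

theorem exists_tops {G : GridData P} (hG : G.IsTwoColorGridPoset) :
    ∃ z : ℕ → P, ∀ i, 1 ≤ i → i ≤ G.m →
      G.chain (z i) = i ∧ ∀ x, G.chain x = i → x ≤ z i := by
  have : ∀ i, ∃ z : P, 1 ≤ i → i ≤ G.m → G.chain z = i ∧ ∀ x, G.chain x = i → x ≤ z := by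
    intro i
    by_cases hi : i ∈ Finset.Icc 1 G.m
    · obtain ⟨u, hu⟩ := hG.1.2.2.1 i hi
      have hne : (Finset.univ.filter (fun x : P => G.chain x = i)).Nonempty :=
        ⟨u, by simp [hu]⟩
      obtain ⟨z, hz, hzm⟩ := Finset.exists_maximal hne
      have hzc : G.chain z = i := (Finset.mem_filter.1 hz).2
      refine ⟨z, fun _ _ => ⟨hzc, fun x hx => ?_⟩⟩
      rcases hG.1.2.2.2.1 x z (hx.trans hzc.symm) with h | h
      · exact h
      · exact hzm (Finset.mem_filter.2 ⟨Finset.mem_univ _, hx⟩) h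
    · obtain ⟨u, _⟩ := hG.1.2.2.1 1 (Finset.mem_Icc.2 ⟨le_rfl, hG.1.1⟩)
      refine ⟨u, fun h1 h2 => absurd (Finset.mem_Icc.2 ⟨h1, h2⟩) hi⟩
  choose z hz using this
  exact ⟨z, hz⟩

theorem exists_select {G : GridData P} (hG : G.IsTwoColorGridPoset) (hmax : G.MaxProperty) :
    ∃ zz : Finset P → P, ∀ t, IsIdeal t → t ≠ Finset.univ →
      Good G t (zz t) ∧ (∀ x, G.chain x = G.chain (zz t) → x ≤ zz t) ∧
      ∀ t', IsIdeal t' → Agree G (G.color (zz t)) t' t → zz t ∉ t' → zz t' = zz t := by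
  obtain ⟨z, hz⟩ := exists_tops hG
  have hch : ∀ x : P, 1 ≤ G.chain x ∧ G.chain x ≤ G.m := fun x =>
    Finset.mem_Icc.1 (hG.1.2.1 x)
  have hmem : ∀ x : P, x ≤ z (G.chain x) := fun x => (hz _ (hch x).1 (hch x).2).2 x rfl
  -- a non-maximal top is below the previous top
  have step : ∀ i, 1 ≤ i → i ≤ G.m → ¬ IsMax (z i) → 2 ≤ i ∧ z i ≤ z (i - 1) := by
    intro i h1 h2 hnm
    rw [not_isMax_iff] at hnm
    obtain ⟨b, hb⟩ := hnm
    obtain ⟨x, hux, -⟩ := exists_covBy_le_of_lt hb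
    have hc := (hz i h1 h2).1
    rcases hG.1.2.2.2.2 _ x hux with h | h
    · exact absurd ((hz i h1 h2).2 x (h.symm.trans hc)) (not_le_of_gt hux.lt)
    · have h3 := hch x
      have h4 : G.chain x = i - 1 := by omega
      refine ⟨by omega, hux.le.trans ?_⟩
      rw [← h4]
      exact hmem x
  have step3 : ∀ i, 3 ≤ i → i ≤ G.m → z i ≤ z (i - 1) := by
    intro i h1 h2
    refine (step i (by omega) h2 fun h => ?_).2
    have := hmax.1 _ h
    rw [(hz i (by omega) h2).1] at this
    omega
  have key : ∃ k0, (k0 = 1 ∨ k0 = 2) ∧ k0 ≤ G.m ∧ (∀ i, k0 < i → i ≤ G.m → z i ≤ z (i - 1)) ∧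
      (k0 = 2 → G.color (z 1) ≠ G.color (z 2)) := by
    by_cases h2 : 2 ≤ G.m ∧ IsMax (z 2)
    · refine ⟨2, Or.inr rfl, h2.1, fun i hi => step3 i hi, fun _ => ?_⟩
      have hm1 : IsMax (z 1) := by
        by_contra h
        have := (step 1 le_rfl (by omega) h).1
        omega
      apply hmax.2 _ _ hm1 h2.2
      intro h
      have e1 := (hz 1 le_rfl (by omega)).1
      have e2 := (hz 2 (by omega) h2.1).1
      rw [h] at e1
      omega
    · refine ⟨1, Or.inl rfl, hG.1.1, ?_, by omega⟩
      intro i h1 h3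
      by_cases h4 : i = 2
      · subst h4
        exact (step 2 (by omega) h3 fun h => h2 ⟨h3, h⟩).2
      · exact step3 i (by omega) h3
  obtain ⟨k0, hk0, hk0m, hstep, hcol⟩ := key
  have anti : ∀ i j, k0 ≤ i → i ≤ j → j ≤ G.m → z j ≤ z i := by
    intro i j hi hij
    induction j, hij using Nat.le_induction with
    | base => intro _; exact le_rfl
    | succ j hj ih =>
      intro hjm
      exact (hstep (j + 1) (by omega) hjm).trans (ih (by omega))
  let Sel : Finset P → ℕ → Prop := fun t k =>
    (k0 ≤ k ∧ k ≤ G.m ∧ Good G t (z k) ∧ ∀ j, k0 ≤ j → j < k → ¬ Good G t (z j)) ∨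
    (k = 1 ∧ k0 = 2 ∧ z 2 ∈ t ∧ z 1 ∉ t)
  have selEx : ∀ t, IsIdeal t → t ≠ Finset.univ → ∃ k, Sel t k := by
    intro t ht hne
    by_cases hE : ∃ k, k0 ≤ k ∧ k ≤ G.m ∧ z k ∉ t
    · -- the largest missing index is good
      have hG0 : ∃ k, k0 ≤ k ∧ k ≤ G.m ∧ Good G t (z k) := by
        let S := (Finset.Icc k0 G.m).filter (fun k => z k ∉ t)
        have hS : S.Nonempty := by
          obtain ⟨k, h1, h2, h3⟩ := hE
          exact ⟨k, by simp [S, h1, h2, h3]⟩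
        have hk := S.max'_mem hS
        set k := S.max' hS with hkdef
        simp only [S, Finset.mem_filter, Finset.mem_Icc] at hk
        refine ⟨k, hk.1.1, hk.1.2, hk.2, fun y hy hc => ?_⟩
        have h1 := chain_anti hG _ _ hy
        rw [(hz k (by omega) hk.1.2).1] at h1
        have h2 : G.chain y ≠ k := by
          intro h
          exact hc (hG.2.1 _ _ (h.trans (hz k (by omega) hk.1.2).1.symm))
        by_contra hyt
        have h3 : G.chain y ∈ S := by
          simp only [S, Finset.mem_filter, Finset.mem_Icc]
          exact ⟨⟨by omega, (hch y).2⟩, fun h => hyt (ht h (hmem y))⟩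
        have := S.le_max' _ h3
        omega
      obtain ⟨h1, h2, h3⟩ := Nat.find_spec hG0
      refine ⟨Nat.find hG0, Or.inl ⟨h1, h2, h3, fun j hj hlt hg => ?_⟩⟩
      exact Nat.find_min hG0 hlt ⟨hj, by omega, hg⟩
    · push Not at hE
      have : ∃ x, x ∉ t := by
        by_contra h
        push Not at h
        exact hne (Finset.eq_univ_iff_forall.2 h)
      obtain ⟨x, hx⟩ := this
      have hzx : z (G.chain x) ∉ t := fun h => hx (ht h (hmem x))
      have h1 : ¬ k0 ≤ G.chain x := fun h => hzx (hE _ h (hch x).2)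
      have h2 := (hch x).1
      have h3 : k0 = 2 := by omega
      have h4 : G.chain x = 1 := by omega
      rw [h4] at hzx
      exact ⟨1, Or.inr ⟨rfl, h3, hE 2 (by omega) (by omega), hzx⟩⟩
  have selUn : ∀ t, IsIdeal t → ∀ k k', Sel t k → Sel t k' → k = k' := by
    intro t ht k k' h h'
    rcases h with ⟨h1, h2, h3, h4⟩ | ⟨h1, h2, h3, h4⟩ <;>
    rcases h' with ⟨h1', h2', h3', h4'⟩ | ⟨h1', h2', h3', h4'⟩
    · rcases lt_trichotomy k k' with h | h | h
      · exact absurd h3 (h4' k h1 h)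
      · exact h
      · exact absurd h3' (h4 k' h1' h)
    · exact absurd (ht h3' (anti 2 k (by omega) (by omega) h2)) h3.1
    · exact absurd (ht h3 (anti 2 k' (by omega) (by omega) h2')) h3'.1
    · omega
  have selGood : ∀ t, IsIdeal t → ∀ k, Sel t k → 1 ≤ k ∧ k ≤ G.m ∧ Good G t (z k) := by
    intro t ht k h
    rcases h with ⟨h1, h2, h3, h4⟩ | ⟨rfl, h2, h3, h4⟩
    · exact ⟨by omega, h2, h3⟩
    · refine ⟨le_rfl, hG.1.1, h4, fun y hy hc => ?_⟩
      have hy1 : G.chain y ≠ 1 := fun h =>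
        hc (hG.2.1 _ _ (h.trans (hz 1 le_rfl hG.1.1).1.symm))
      have := hch y
      exact ht h3 ((hmem y).trans (anti 2 _ (by omega) (by omega) this.2))
  have selTr : ∀ t, IsIdeal t → ∀ k, Sel t k → ∀ t', IsIdeal t' →
      Agree G (G.color (z k)) t' t → z k ∉ t' → Sel t' k := by
    intro t ht k h t' ht' hag hk
    rcases h with ⟨h1, h2, h3, h4⟩ | ⟨rfl, h2, h3, h4⟩
    · refine Or.inl ⟨h1, h2, ⟨hk, fun y hy hc => (hag y hc).2 (h3.2 y hy hc)⟩, ?_⟩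
      intro j hj hjk hg
      have hle := anti j k hj hjk.le h2
      by_cases hc : G.color (z j) = G.color (z k)
      · apply h4 j hj hjk
        refine ⟨fun h => h3.1 (ht h hle), fun y hy hcy => ?_⟩
        exact (hag y (hc ▸ hcy)).1 (hg.2 y hy hcy)
      · exact hk (hg.2 _ hle (Ne.symm hc))
    · exact Or.inr ⟨rfl, h2, (hag _ (hcol h2).symm).2 h3, hk⟩
  choose! K hK using selEx
  refine ⟨fun t => z (K t), fun t ht hne => ?_⟩
  have hs := hK t ht hne
  obtain ⟨g1, g2, g3⟩ := selGood t ht _ hs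
  refine ⟨g3, ?_, ?_⟩
  · intro x hx
    exact (hz _ g1 g2).2 x (hx.trans (hz _ g1 g2).1)
  · intro t' ht' hag hn
    have hne' : t' ≠ Finset.univ := by
      rintro rfl; exact hn (Finset.mem_univ _)
    have hs' := selTr t ht _ hs t' ht' hag hn
    dsimp only
    rw [selUn t' ht' _ _ (hK t' ht' hne') hs']

theorem exists_inv2 {G : GridData P} (hG : G.IsTwoColorGridPoset) (hmax : G.MaxProperty)
    (hM : G.MStructured !![2, -1; -3, 2]) :
    ∃ ψ : Finset P → Finset P, ∀ t, IsIdeal t → t ≠ Finset.univ →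
      IsIdeal (ψ t) ∧ ψ t ≠ Finset.univ ∧ ψ (ψ t) = t ∧
      ∃ γ, G.wt (ψ t) + ![1, 1] = (Smat γ).mulVec (G.wt t + ![1, 1]) := by
  obtain ⟨zz, hzz⟩ := exists_select hG hmax
  refine ⟨fun t => refl (botI G (G.color (zz t)) t) ((topI G (G.color (zz t)) t).erase (zz t)) t,
    ?_⟩
  intro t ht hne
  obtain ⟨⟨hz1, hz2⟩, hztop, hzc⟩ := hzz t ht hne
  dsimp only
  set v := zz t with hv
  set γ := G.color v with hγ
  have hvtop : v ∈ topI G γ t := mem_topI.2 hz2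
  have hvbot : v ∉ botI G γ t := fun h => hz1 (botI_subset ht h)
  have hTid : IsIdeal ((topI G γ t).erase v) := by
    intro x hx y hyx
    obtain ⟨hxv, hx⟩ := Finset.mem_erase.1 hx
    refine Finset.mem_erase.2 ⟨?_, isIdeal_topI _ _ _ hx hyx⟩
    rintro rfl
    have hxb : x ∉ botI G γ t := fun h => hvbot (isIdeal_botI _ _ _ h hyx)
    have := free_chain hG _ _ hvtop hx hvbot hxb hyx
    exact hxv (le_antisymm (hztop x this.symm) hyx)
  have htT : t ⊆ (topI G γ t).erase v := by
    intro x hx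
    refine Finset.mem_erase.2 ⟨?_, subset_topI ht hx⟩
    rintro rfl
    exact hz1 hx
  obtain ⟨h1, h2, h3, h4, h5⟩ := refl_spec hG (isIdeal_botI G γ t) hTid
    ((botI_subset ht).trans htT)
    (fun x y hx hy => free_chain hG x y (Finset.mem_of_mem_erase hx) (Finset.mem_of_mem_erase hy))
    ht (botI_subset ht) htT
  set t' := refl (botI G γ t) ((topI G γ t).erase v) t with ht'
  have hag := agree_of_between h2 (h3.trans (Finset.erase_subset _ _))
  have hvt' : v ∉ t' := fun h => (Finset.mem_erase.1 (h3 h)).1 rfl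
  have hzt' : zz t' = v := hzc t' h1 hag hvt'
  refine ⟨h1, ?_, ?_, γ, ?_⟩
  · intro h
    exact hvt' (h ▸ Finset.mem_univ _)
  · rw [hzt', ← hγ, botI_congr hag, topI_congr hag, h5]
  · rw [Finset.card_erase_of_mem hvtop] at h4
    have hpos : 0 < (topI G γ t).card := Finset.card_pos.2 ⟨v, hvtop⟩
    rw [wt_of_agree hM h1 ht hag, Smat_mulVec]
    have e : (G.wt t + (![1, 1] : Fin 2 → ℤ)) γ = -((t'.card : ℤ) - t.card) := by
      have : (![1, 1] : Fin 2 → ℤ) γ = 1 := by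
        generalize γ = g
        fin_cases g <;> rfl
      rw [Pi.add_apply, wt_apply, mcoord_eq ht, this]
      omega
    rw [e]
    module

end GridProof

namespace GridProof

theorem Smat_sq (γ : Fin 2) : Smat γ * Smat γ = 1 := by
  ext i j
  fin_cases γ <;> fin_cases i <;> fin_cases j <;>
    simp [Smat, Matrix.mul_apply, Fin.sum_univ_two]

/-- The reflection as a unit. -/
def Sunit (γ : Fin 2) : (Matrix (Fin 2) (Fin 2) ℤ)ˣ := ⟨Smat γ, Smat γ, Smat_sq γ, Smat_sq γ⟩

/-- The subgroup generated by the two reflections. -/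
def Wgrp : Subgroup ((Matrix (Fin 2) (Fin 2) ℤ)ˣ) :=
  Subgroup.closure (genSet !![-1, 0; 1, 1] !![1, 3; 0, -1])

theorem genSet_eq (w : (Matrix (Fin 2) (Fin 2) ℤ)ˣ)
    (hw : w ∈ genSet !![-1, 0; 1, 1] !![1, 3; 0, -1]) : ∃ γ, w = Sunit γ := by
  rcases hw with h | h
  · exact ⟨0, Units.ext (by rw [h]; rfl)⟩
  · exact ⟨1, Units.ext (by rw [h]; rfl)⟩

theorem Sunit_mem (γ : Fin 2) : Sunit γ ∈ Wgrp := by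
  apply Subgroup.subset_closure
  fin_cases γ
  · exact Or.inl rfl
  · exact Or.inr rfl

/-- The twelve elements of the Weyl group. -/
def elts : List (ℤ × ℤ × ℤ × ℤ) :=
  [(1, 0, 0, 1), (-1, 0, 1, 1), (1, 3, 0, -1), (-1, -3, 1, 2), (2, 3, -1, -1), (-2, -3, 1, 1),
   (1, 3, -1, -2), (-1, 0, 0, -1), (1, 0, -1, -1), (-1, -3, 0, 1), (-2, -3, 1, 2), (2, 3, -1, -2)]

theorem elts_closed (γ : Fin 2) (p : ℤ × ℤ × ℤ × ℤ) (hp : p ∈ elts) :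
    ∃ q ∈ elts, Smat γ * !![p.1, p.2.1; p.2.2.1, p.2.2.2] =
      !![q.1, q.2.1; q.2.2.1, q.2.2.2] := by
  have h : ∀ p ∈ elts, (-p.1, -p.2.1, p.1 + p.2.2.1, p.2.1 + p.2.2.2) ∈ elts ∧
      (p.1 + 3 * p.2.2.1, p.2.1 + 3 * p.2.2.2, -p.2.2.1, -p.2.2.2) ∈ elts := by decide
  fin_cases γ
  · refine ⟨_, (h p hp).1, ?_⟩
    ext i j
    fin_cases i <;> fin_cases j <;> simp [Smat, Matrix.mul_apply, Fin.sum_univ_two]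
  · refine ⟨_, (h p hp).2, ?_⟩
    ext i j
    fin_cases i <;> fin_cases j <;> simp [Smat, Matrix.mul_apply, Fin.sum_univ_two]

theorem Wgrp_elts (w : (Matrix (Fin 2) (Fin 2) ℤ)ˣ) (hw : w ∈ Wgrp) :
    ∃ q ∈ elts, (w : Matrix (Fin 2) (Fin 2) ℤ) = !![q.1, q.2.1; q.2.2.1, q.2.2.2] := by
  induction hw using Subgroup.closure_induction_left with
  | one =>
    refine ⟨(1, 0, 0, 1), by decide, ?_⟩
    exact Matrix.one_fin_two
  | mul_left x hx y hy ih =>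
    obtain ⟨γ, rfl⟩ := genSet_eq x hx
    obtain ⟨p, hp, e⟩ := ih
    rw [Units.val_mul, e]
    exact elts_closed γ p hp
  | inv_mul_cancel x hx y hy ih =>
    obtain ⟨γ, rfl⟩ := genSet_eq x hx
    obtain ⟨p, hp, e⟩ := ih
    rw [Units.val_mul, e]
    exact elts_closed γ p hp

theorem Wgrp_finite : (Wgrp : Set ((Matrix (Fin 2) (Fin 2) ℤ)ˣ)).Finite := by
  have h1 : ((fun q : ℤ × ℤ × ℤ × ℤ => (!![q.1, q.2.1; q.2.2.1, q.2.2.2] :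
      Matrix (Fin 2) (Fin 2) ℤ)) '' {q | q ∈ elts}).Finite :=
    (List.finite_toSet elts).image _
  refine Set.Finite.of_finite_image (f := Units.val) (h1.subset ?_) (fun a _ b _ h => Units.ext h)
  rintro _ ⟨w, hw, rfl⟩
  obtain ⟨q, hq, e⟩ := Wgrp_elts w hw
  exact ⟨q, hq, e.symm⟩

theorem Smat_det (γ : Fin 2) : (Smat γ).det = -1 := by
  fin_cases γ <;> simp [Smat, Matrix.det_fin_two]

/-- The elements of the group as a finset. -/
noncomputable def WF : Finset ((Matrix (Fin 2) (Fin 2) ℤ)ˣ) := Wgrp_finite.toFinset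

theorem mem_WF {w : (Matrix (Fin 2) (Fin 2) ℤ)ˣ} : w ∈ WF ↔ w ∈ Wgrp := by simp [WF]

/-- The alternating sum over the Weyl group. -/
noncomputable def Alt (μ : Fin 2 → ℤ) : AddMonoidAlgebra ℤ (Fin 2 → ℤ) :=
  ∑ w ∈ WF, AddMonoidAlgebra.single
    ((w : Matrix (Fin 2) (Fin 2) ℤ).mulVec μ) ((w : Matrix (Fin 2) (Fin 2) ℤ).det)

theorem Alt_neg (γ : Fin 2) (μ : Fin 2 → ℤ) : Alt ((Smat γ).mulVec μ) = - Alt μ := by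
  unfold Alt
  rw [← Finset.sum_neg_distrib]
  have hS : Sunit γ * Sunit γ = 1 := Units.ext (Smat_sq γ)
  apply Finset.sum_nbij' (fun w => w * Sunit γ) (fun w => w * Sunit γ)
  · intro w hw
    exact mem_WF.2 (Wgrp.mul_mem (mem_WF.1 hw) (Sunit_mem γ))
  · intro w hw
    exact mem_WF.2 (Wgrp.mul_mem (mem_WF.1 hw) (Sunit_mem γ))
  · intro w _
    rw [mul_assoc, hS, mul_one]
  · intro w _
    rw [mul_assoc, hS, mul_one]
  · intro w _
    have e : ((w * Sunit γ : (Matrix (Fin 2) (Fin 2) ℤ)ˣ) : Matrix (Fin 2) (Fin 2) ℤ)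
      = w * Smat γ := rfl
    rw [e, Matrix.mulVec_mulVec, Matrix.det_mul, Smat_det, mul_neg_one,
      AddMonoidAlgebra.single_neg, neg_neg]

variable {P : Type} [PartialOrder P] [Fintype P]

theorem sum_invariant {G : GridData P} (hG : G.IsTwoColorGridPoset)
    (hM : G.MStructured !![2, -1; -3, 2]) (w : (Matrix (Fin 2) (Fin 2) ℤ)ˣ) (hw : w ∈ Wgrp) :
    ∀ f : (Fin 2 → ℤ) → AddMonoidAlgebra ℤ (Fin 2 → ℤ),
    ∑ t ∈ Finset.univ.filter (fun t : Finset P => IsIdeal t),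
      f ((w : Matrix (Fin 2) (Fin 2) ℤ).mulVec (G.wt t)) =
    ∑ t ∈ Finset.univ.filter (fun t : Finset P => IsIdeal t), f (G.wt t) := by
  induction hw using Subgroup.closure_induction with
  | mem x hx =>
    intro f
    obtain ⟨γ, rfl⟩ := genSet_eq x hx
    obtain ⟨φ, hφ⟩ := exists_inv1 hG hM γ
    apply Finset.sum_nbij' φ φ
    · intro t ht
      simp only [Finset.mem_filter, Finset.mem_univ, true_and] at ht ⊢
      exact (hφ t ht).1
    · intro t ht
      simp only [Finset.mem_filter, Finset.mem_univ, true_and] at ht ⊢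
      exact (hφ t ht).1
    · intro t ht
      simp only [Finset.mem_filter, Finset.mem_univ, true_and] at ht
      exact (hφ t ht).2.1
    · intro t ht
      simp only [Finset.mem_filter, Finset.mem_univ, true_and] at ht
      exact (hφ t ht).2.1
    · intro t ht
      simp only [Finset.mem_filter, Finset.mem_univ, true_and] at ht
      rw [(hφ t ht).2.2]
      rfl
  | one => intro f; simp
  | mul x y _ _ hx hy =>
    intro f
    rw [← hx f, ← hy (fun v => f ((x : Matrix (Fin 2) (Fin 2) ℤ).mulVec v))]
    simp only [Matrix.mulVec_mulVec, Units.val_mul]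
  | inv x _ hx =>
    intro f
    rw [← hx (fun v => f (((x⁻¹ : (Matrix (Fin 2) (Fin 2) ℤ)ˣ) :
      Matrix (Fin 2) (Fin 2) ℤ).mulVec v))]
    apply Finset.sum_congr rfl
    intro t _
    rw [Matrix.mulVec_mulVec, ← Units.val_mul, inv_mul_cancel, Units.val_one, Matrix.one_mulVec]

theorem main_prod {G : GridData P} (hG : G.IsTwoColorGridPoset)
    (hM : G.MStructured !![2, -1; -3, 2]) :
    (∑ t ∈ Finset.univ.filter (fun t : Finset P => IsIdeal t),
        AddMonoidAlgebra.single (G.wt t) (1 : ℤ)) * Alt ![1, 1] =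
    ∑ t ∈ Finset.univ.filter (fun t : Finset P => IsIdeal t), Alt (G.wt t + ![1, 1]) := by
  unfold Alt
  rw [Finset.sum_comm, Finset.mul_sum]
  apply Finset.sum_congr rfl
  intro w hw
  rw [Finset.sum_mul]
  rw [← sum_invariant hG hM w (mem_WF.1 hw) (fun v => AddMonoidAlgebra.single v (1 : ℤ) *
    AddMonoidAlgebra.single ((w : Matrix (Fin 2) (Fin 2) ℤ).mulVec ![1, 1])
      ((w : Matrix (Fin 2) (Fin 2) ℤ).det))]
  apply Finset.sum_congr rfl
  intro t _
  rw [AddMonoidAlgebra.single_mul_single, one_mul, Matrix.mulVec_add]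

theorem main_sum {G : GridData P} (hG : G.IsTwoColorGridPoset) (hmax : G.MaxProperty)
    (hM : G.MStructured !![2, -1; -3, 2]) :
    ∑ t ∈ Finset.univ.filter (fun t : Finset P => IsIdeal t), Alt (G.wt t + ![1, 1]) =
    Alt (G.wt Finset.univ + ![1, 1]) := by
  have hu : (Finset.univ : Finset P) ∈ Finset.univ.filter (fun t : Finset P => IsIdeal t) := by
    simp only [Finset.mem_filter, Finset.mem_univ, true_and]
    intro x _ y _
    exact Finset.mem_univ y
  rw [← Finset.add_sum_erase _ _ hu, add_eq_left]
  obtain ⟨ψ, hψ⟩ := exists_inv2 hG hmax hM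
  have hmem : ∀ t, t ∈ (Finset.univ.filter (fun t : Finset P => IsIdeal t)).erase Finset.univ ↔
      t ≠ Finset.univ ∧ IsIdeal t := by
    intro t; simp
  have hneg : ∀ t, t ∈ (Finset.univ.filter (fun t : Finset P => IsIdeal t)).erase Finset.univ →
      Alt (G.wt (ψ t) + ![1, 1]) = - Alt (G.wt t + ![1, 1]) := by
    intro t ht
    obtain ⟨h1, h2⟩ := (hmem t).1 ht
    obtain ⟨γ, h⟩ := (hψ t h2 h1).2.2.2
    rw [h, Alt_neg]
  refine Finset.sum_involution (fun t _ => ψ t) ?_ ?_ ?_ ?_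
  · intro t ht
    rw [hneg t ht, add_neg_cancel]
  · intro t ht hne heq
    have := hneg t ht
    rw [heq] at this
    apply hne
    ext a
    have h2 := congrArg (fun p => AddMonoidAlgebra.coeff p a) this
    simp only [AddMonoidAlgebra.coeff_neg, Finsupp.neg_apply] at h2
    simp only [AddMonoidAlgebra.coeff_zero, Finsupp.zero_apply]
    omega
  · intro t ht
    obtain ⟨h1, h2⟩ := (hmem t).1 ht
    exact (hmem _).2 ⟨(hψ t h2 h1).2.1, (hψ t h2 h1).1⟩
  · intro t ht
    obtain ⟨h1, h2⟩ := (hmem t).1 ht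
    exact (hψ t h2 h1).2.2.1

end GridProof

theorem stmt_3 {P : Type} [PartialOrder P] [Fintype P] (G : GridData P)
    (hG : G.IsTwoColorGridPoset) (hmax : G.MaxProperty)
    (hM : G.MStructured !![2, -1; -3, 2])
    (a b : ℤ) (ha : a = G.wt Finset.univ 0) (hb : b = G.wt Finset.univ 1)
    (W : Subgroup ((Matrix (Fin 2) (Fin 2) ℤ)ˣ))
    (hW : W = Subgroup.closure (genSet !![-1, 0; 1, 1] !![1, 3; 0, -1])) :
    (∑ t ∈ Finset.univ.filter (fun t : Finset P => IsIdeal t),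
        AddMonoidAlgebra.single (G.wt t) (1 : ℤ)) *
      (∑ᶠ w ∈ (W : Set ((Matrix (Fin 2) (Fin 2) ℤ)ˣ)), AddMonoidAlgebra.single
          ((w : Matrix (Fin 2) (Fin 2) ℤ).mulVec ![1, 1])
          ((w : Matrix (Fin 2) (Fin 2) ℤ).det)) =
    ∑ᶠ w ∈ (W : Set ((Matrix (Fin 2) (Fin 2) ℤ)ˣ)), AddMonoidAlgebra.single
        ((w : Matrix (Fin 2) (Fin 2) ℤ).mulVec ![a + 1, b + 1])
        ((w : Matrix (Fin 2) (Fin 2) ℤ).det) := by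
  subst hW ha hb
  change _ * (∑ᶠ w ∈ (GridProof.Wgrp : Set ((Matrix (Fin 2) (Fin 2) ℤ)ˣ)), _) =
    ∑ᶠ w ∈ (GridProof.Wgrp : Set ((Matrix (Fin 2) (Fin 2) ℤ)ˣ)), _
  rw [finsum_mem_eq_finite_toFinset_sum _ GridProof.Wgrp_finite,
    finsum_mem_eq_finite_toFinset_sum _ GridProof.Wgrp_finite]
  have e : (![G.wt Finset.univ 0 + 1, G.wt Finset.univ 1 + 1] : Fin 2 → ℤ)
      = G.wt Finset.univ + ![1, 1] := by
    funext i
    fin_cases i <;> rfl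
  rw [e]
  exact (GridProof.main_prod hG hM).trans (GridProof.main_sum hG hmax hM)
end
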